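/- (Simon) Let 0 < α ≤ 1 and p > 1/(1+α). Then there is a constant c_p such that for every N ∈ N, ∫_{G ∖ I_N} ( sup_{n ≥ 2^N} ∫_{I_N} |K_n^{κ,α}(x+t)| dμ(t) )^p dμ(x) ≤ c_p 2^{−N}. -/

import Mathlib

open MeasureTheory Filter Finset ENNReal

noncomputable section

/-- The Walsh group `G`: countable product of copies of `ℤ/2ℤ`. -/
abbrev WG : Type := ℕ → ZMod 2

/-- The normalized Haar measure (= product of uniform coin-toss measures) on `G`. -/
def μW : Measure WG := Measure.addHaarMeasure ⊤

instance : (μW).Regular := by unfold μW; infer_instance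

instance : IsFiniteMeasure μW := by
  constructor
  rw [← TopologicalSpace.PositiveCompacts.coe_top (α := WG)]
  exact IsCompact.measure_lt_top (⊤ : TopologicalSpace.PositiveCompacts WG).isCompact

/-- The product measure on `G^d`. -/
def μD (d : ℕ) : Measure (Fin d → WG) := Measure.pi fun _ => μW

/-- The `k`-th Rademacher function. -/
def rad (k : ℕ) (x : WG) : ℝ := (-1 : ℝ) ^ (x k).val

/-- The Walsh–Paley function of index `n`. -/
def walsh (n : ℕ) (x : WG) : ℝ :=
  ∏ k ∈ Finset.range n.size, if n.testBit k then rad k x else 1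

/-- The Walsh–Kaczmarz function of index `n`; `Nat.log 2 n` is the order `|n|`. -/
def kacz (n : ℕ) (x : WG) : ℝ :=
  if n = 0 then 1 else
    rad (Nat.log 2 n) x *
      (-1 : ℝ) ^ (∑ k ∈ Finset.range (Nat.log 2 n),
        (if n.testBit k then 1 else 0) * (x (Nat.log 2 n - 1 - k)).val)

/-- The `d`-dimensional Walsh–Kaczmarz function. -/
def kaczD (d : ℕ) (m : Fin d → ℕ) (x : Fin d → WG) : ℝ := ∏ i, kacz (m i) (x i)

/-- Walsh–Paley Dirichlet kernel. -/
def dirW (n : ℕ) (x : WG) : ℝ := ∑ k ∈ Finset.range n, walsh k x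

/-- Walsh–Kaczmarz Dirichlet kernel. -/
def dirK (n : ℕ) (x : WG) : ℝ := ∑ k ∈ Finset.range n, kacz k x

/-- `A_j^α = binom (j+α) j`. -/
def Abin (α : ℝ) (j : ℕ) : ℝ := ∏ i ∈ Finset.range j, (α + i + 1) / (i + 1)

/-- One-dimensional Walsh–Paley `(C,α)` kernel. -/
def KW (α : ℝ) (n : ℕ) (x : WG) : ℝ :=
  (Abin α n)⁻¹ * ∑ k ∈ Finset.range (n + 1), Abin (α - 1) (n - k) * dirW k x

/-- One-dimensional Walsh–Kaczmarz `(C,α)` kernel. -/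
def KK (α : ℝ) (n : ℕ) (x : WG) : ℝ :=
  (Abin α n)⁻¹ * ∑ k ∈ Finset.range (n + 1), Abin (α - 1) (n - k) * dirK k x

/-- The `m`-th Walsh–Kaczmarz–Fourier coefficient of `f : G^d → ℝ`. -/
def fCoeff (d : ℕ) (f : (Fin d → WG) → ℝ) (m : Fin d → ℕ) : ℝ :=
  ∫ x, f x * kaczD d m x ∂ μD d

/-- Rectangular partial sum built from an abstract family `c` of Fourier coefficients. -/
def partialSumOf (d : ℕ) (c : (Fin d → ℕ) → ℝ) (k : Fin d → ℕ) (x : Fin d → WG) : ℝ :=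
  ∑ m ∈ Fintype.piFinset (fun i => Finset.range (k i)), c m * kaczD d m x

/-- `(C,α)` (Cesàro) mean of order `n` built from coefficients `c`. -/
def cesaroOf (d : ℕ) (α : Fin d → ℝ) (c : (Fin d → ℕ) → ℝ) (n : Fin d → ℕ)
    (x : Fin d → WG) : ℝ :=
  (∏ i, Abin (α i) (n i))⁻¹ *
    ∑ k ∈ Fintype.piFinset (fun i => Finset.range (n i + 1)),
      (∏ i, Abin (α i - 1) (n i - k i)) * partialSumOf d c k x

/-- A cone-like restriction function (CRF) family `γ = (γ_j)_{j ≠ 0}`. -/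
structure IsCRF (d : ℕ) [NeZero d] (γ : Fin d → ℝ → ℝ) : Prop where
  strictMono : ∀ j : Fin d, j ≠ 0 → StrictMonoOn (γ j) (Set.Ici 1)
  contOn : ∀ j : Fin d, j ≠ 0 → ContinuousOn (γ j) (Set.Ici 1)
  one_le : ∀ j : Fin d, j ≠ 0 → ∀ x : ℝ, 1 ≤ x → 1 ≤ γ j x
  map_one : ∀ j : Fin d, j ≠ 0 → γ j 1 = 1
  tendsto_atTop : ∀ j : Fin d, j ≠ 0 → Tendsto (γ j) atTop atTop
  reg : ∃ ζ : ℝ, 1 < ζ ∧ ∀ j : Fin d, j ≠ 0 → ∃ c₁ c₂ : ℝ, 1 < c₁ ∧ 1 < c₂ ∧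
    ∀ x : ℝ, 1 ≤ x → c₁ * γ j x ≤ γ j (ζ * x) ∧ γ j (ζ * x) ≤ c₂ * γ j x

/-- The cone-like set `L` determined by `γ` and the parameters `β`. -/
def coneLike (d : ℕ) [NeZero d] (γ : Fin d → ℝ → ℝ) (β : Fin d → ℝ) : Set (Fin d → ℕ) :=
  {n | ∀ j : Fin d, j ≠ 0 → (β j)⁻¹ * γ j (n 0) ≤ (n j : ℝ) ∧ (n j : ℝ) ≤ β j * γ j (n 0)}

/-- `bar γ n₁ = (n₁, n₂, …, n_d)` where `n_j = |γ_j(2^{n₁})|` is the order of `γ_j(2^{n₁})`,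
i.e. `2^{n_j} ≤ γ_j(2^{n₁}) < 2^{n_j+1}`. -/
def bar (d : ℕ) [NeZero d] (γ : Fin d → ℝ → ℝ) (n₁ : ℕ) : Fin d → ℕ :=
  fun j => if j = 0 then n₁ else Nat.log 2 ⌊γ j ((2 : ℝ) ^ n₁)⌋₊

/-- The cone-like restricted maximal operator `σ_L^{κ,α,*}` (built from coefficients `c`). -/
def cesaroMaximal (d : ℕ) [NeZero d] (α : Fin d → ℝ) (γ : Fin d → ℝ → ℝ) (β : Fin d → ℝ)
    (c : (Fin d → ℕ) → ℝ) (x : Fin d → WG) : ℝ≥0∞ :=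
  ⨆ n ∈ coneLike d γ β, ENNReal.ofReal |cesaroOf d α c n x|

/-- `L^p`-"norm" (`0 < p < ∞`) of an `ℝ≥0∞`-valued function on `G^d`. -/
def lpNormE (d : ℕ) (p : ℝ) (g : (Fin d → WG) → ℝ≥0∞) : ℝ≥0∞ :=
  (∫⁻ x, g x ^ p ∂ μD d) ^ (1 / p)

/-- The dyadic rectangle `I_{N}(y) = I_{N_1}(y^1) × ⋯ × I_{N_d}(y^d)`. -/
def rectAt (d : ℕ) (N : Fin d → ℕ) (y : Fin d → WG) : Set (Fin d → WG) :=
  {x | ∀ j : Fin d, ∀ i : ℕ, i < N j → x j i = y j i}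

/-- The one-dimensional dyadic interval `I_N = I_N(0)`. -/
def rectW (N : ℕ) : Set WG := {x | ∀ i : ℕ, i < N → x i = 0}

/-- A one-parameter martingale with respect to the filtration
`(F_{bar γ n₁})_{n₁}` generated by the dyadic rectangles `I_{bar γ n₁}(y)`
(measurability w.r.t. this atomic σ-algebra = being constant on its rectangles,
and the martingale property = equality of integrals over the rectangles). -/
structure ConeMartingale (d : ℕ) [NeZero d] (γ : Fin d → ℝ → ℝ) where
  F : ℕ → (Fin d → WG) → ℝ
  integrable : ∀ n₁, Integrable (F n₁) (μD d)
  adapted : ∀ n₁ (x y : Fin d → WG),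
    (∀ j : Fin d, ∀ i : ℕ, i < bar d γ n₁ j → x j i = y j i) → F n₁ x = F n₁ y
  mart : ∀ n₁ m₁, n₁ ≤ m₁ → ∀ y,
    ∫ x in rectAt d (bar d γ n₁) y, F m₁ x ∂ μD d
      = ∫ x in rectAt d (bar d γ n₁) y, F n₁ x ∂ μD d

/-- The Fourier coefficients of a martingale (the integrals `∫ f_k ψ_m` stabilize). -/
def martCoeff (d : ℕ) [NeZero d] (γ : Fin d → ℝ → ℝ) (f : ConeMartingale d γ) (m : Fin d → ℕ) : ℝ :=
  limUnder atTop (fun k => ∫ x, f.F k x * kaczD d m x ∂ μD d)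

/-- The maximal function `f* = sup_{n₁} |f_{bar n₁}|` of a martingale. -/
def martMaximal (d : ℕ) [NeZero d] (γ : Fin d → ℝ → ℝ) (f : ConeMartingale d γ)
    (x : Fin d → WG) : ℝ≥0∞ :=
  ⨆ n₁ : ℕ, ENNReal.ofReal |f.F n₁ x|

/-- The martingale Hardy space "norm" `‖f‖_{H_p^γ} = ‖f*‖_p`. -/
def hardyNorm (d : ℕ) [NeZero d] (γ : Fin d → ℝ → ℝ) (p : ℝ) (f : ConeMartingale d γ) : ℝ≥0∞ :=
  lpNormE d p (martMaximal d γ f)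

/-- A `p`-atom supported on the rectangle `I_N(y)`. -/
structure IsPAtom (d : ℕ) (p : ℝ) (a : (Fin d → WG) → ℝ) (N : Fin d → ℕ)
    (y : Fin d → WG) : Prop where
  measurable : Measurable a
  support : ∀ x, x ∉ rectAt d N y → a x = 0
  bound : ∀ x, |a x| ≤ ((μD d (rectAt d N y)).toReal) ^ (-(1 / p))
  zero : ∫ x, a x ∂ μD d = 0

/-- The conditional-expectation (dyadic average) of `f` at level `N`. -/
def avgAt (d : ℕ) (N : Fin d → ℕ) (f : (Fin d → WG) → ℝ) (x : Fin d → WG) : ℝ :=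
  (2 : ℝ) ^ (∑ j, N j) * ∫ t in rectAt d N x, f t ∂ μD d

/-- `m` is the martingale generated by the integrable function `f`. -/
def inducedLevels (d : ℕ) [NeZero d] (γ : Fin d → ℝ → ℝ) (f : (Fin d → WG) → ℝ)
    (m : ConeMartingale d γ) : Prop :=
  ∀ n₁ x, m.F n₁ x = avgAt d (bar d γ n₁) f x

/-- The martingale maximal function of (the martingale generated by) a function `f`,
`f* = sup_{n₁} |S_{2^{bar γ n₁}} f|`. -/
def funMaximal (d : ℕ) [NeZero d] (γ : Fin d → ℝ → ℝ) (f : (Fin d → WG) → ℝ)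
    (x : Fin d → WG) : ℝ≥0∞ :=
  ⨆ n₁ : ℕ, ENNReal.ofReal |partialSumOf d (fCoeff d f) (fun j => 2 ^ bar d γ n₁ j) x|

/-- The Hardy norm `‖f‖_{H_p^γ}` of (the martingale generated by) a function `f`. -/
def funHardyNorm (d : ℕ) [NeZero d] (γ : Fin d → ℝ → ℝ) (p : ℝ) (f : (Fin d → WG) → ℝ) : ℝ≥0∞ :=
  lpNormE d p (funMaximal d γ f)

/-- Skvortsov's bit-reversal transformation `τ_A`. -/
def tau (A : ℕ) (x : WG) : WG := fun i => if i < A then x (A - 1 - i) else x i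

end

noncomputable section

lemma Abin_succ (α : ℝ) (m : ℕ) : Abin α (m + 1) = Abin α m * ((α + m + 1) / (m + 1)) := by
  rw [Abin, Finset.prod_range_succ, ← Abin]

lemma Abin_zero (α : ℝ) : Abin α 0 = 1 := by simp [Abin]

lemma Abin_sub_one_succ (α : ℝ) (m : ℕ) :
    Abin (α - 1) (m + 1) = α / (m + 1) * Abin α m := by
  induction m with
  | zero => simp [Abin]
  | succ m ih =>
    rw [Abin_succ, ih, Abin_succ α m]
    push_cast
    field_simp
    ring

lemma Abin_succ_sub (α : ℝ) (m : ℕ) :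
    Abin α (m + 1) - Abin α m = Abin (α - 1) (m + 1) := by
  rw [Abin_sub_one_succ, Abin_succ]
  field_simp
  ring

lemma sum_Abin_sub_one (α : ℝ) (m : ℕ) :
    ∑ i ∈ Finset.range (m + 1), Abin (α - 1) i = Abin α m := by
  induction m with
  | zero => simp [Abin]
  | succ m ih => rw [Finset.sum_range_succ, ih, ← Abin_succ_sub]; ring

lemma Abin_nonneg {α : ℝ} (hα : 0 < α) (m : ℕ) : 0 ≤ Abin α m :=
  Finset.prod_nonneg fun _ _ => by positivity

lemma Abin_monotone {α : ℝ} (hα : 0 < α) : Monotone (Abin α) := by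
  refine monotone_nat_of_le_succ fun m => ?_
  have h := Abin_succ_sub α m
  rw [Abin_sub_one_succ] at h
  have h2 : 0 ≤ α / (m + 1) * Abin α m := mul_nonneg (by positivity) (Abin_nonneg hα m)
  linarith

lemma Abin_concave {α : ℝ} (hα : 0 < α) (hα1 : α ≤ 1) (m : ℕ) :
    Abin α (m + 2) - Abin α (m + 1) ≤ Abin α (m + 1) - Abin α m := by
  rw [Abin_succ_sub, Abin_succ_sub, Abin_succ (α - 1) (m + 1)]
  have h : 0 ≤ Abin (α - 1) (m + 1) := by
    rw [Abin_sub_one_succ]; exact mul_nonneg (by positivity) (Abin_nonneg hα m)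
  refine mul_le_of_le_one_right h ?_
  rw [div_le_one (by positivity)]
  linarith

lemma Abin_diff_antitone {α : ℝ} (hα : 0 < α) (hα1 : α ≤ 1) :
    Antitone fun m => Abin α (m + 1) - Abin α m :=
  antitone_nat_of_succ_le fun m => Abin_concave hα hα1 m

lemma Abin_add_sub_le {α : ℝ} (hα : 0 < α) (hα1 : α ≤ 1) (u v : ℕ) :
    Abin α (u + v) - Abin α u ≤ Abin α v - 1 := by
  induction v with
  | zero => simp [Abin_zero]
  | succ v ih =>
    have h := Abin_diff_antitone hα hα1 (Nat.le_add_left v u)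
    simp only at h
    rw [← add_assoc]
    linarith

lemma le_Abin {α : ℝ} (hα : 0 < α) (hα1 : α ≤ 1) (m : ℕ) :
    ((m : ℝ) + 1) ^ α ≤ Abin α m := by
  induction m with
  | zero => simp [Abin_zero]
  | succ m ih =>
    rw [Abin_succ]
    have h1 : ((m + 1 : ℕ) : ℝ) + 1 = (m + 1) * (1 + 1 / (m + 1)) := by
      push_cast; field_simp
    rw [h1, Real.mul_rpow (by positivity) (by positivity)]
    refine mul_le_mul ih ?_ (by positivity) (Abin_nonneg hα m)
    have := rpow_one_add_le_one_add_mul_self (s := 1 / ((m : ℝ) + 1))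
      (by have : (0:ℝ) ≤ 1 / ((m : ℝ) + 1) := by positivity
          linarith) hα.le hα1
    refine this.trans (le_of_eq ?_)
    field_simp
    ring

lemma Abin_succ_le {α : ℝ} (hα : 0 < α) (hα1 : α ≤ 1) (m : ℕ) :
    Abin α (m + 1) ≤ 2 * ((m : ℝ) + 1) ^ α := by
  induction m with
  | zero => simp [Abin]; linarith
  | succ m ih =>
    rw [Abin_succ]
    have hm : (0 : ℝ) < (m : ℝ) + 2 := by positivity
    have hu : α / ((m : ℝ) + 2) ≤ 1 := by
      rw [div_le_one hm]; linarith [(Nat.cast_nonneg m : (0 : ℝ) ≤ m)]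
    have h0 : (α + (m + 1 : ℕ) + 1) / ((m + 1 : ℕ) + 1) = 1 + α / ((m : ℝ) + 2) := by
      push_cast
      field_simp
      ring
    have h1 : (m : ℝ) + 1 = (m + 2) * (1 + -(1 / (m + 2))) := by field_simp; ring
    have h2 : -1 ≤ -(1 / ((m : ℝ) + 2)) := by
      rw [neg_le_neg_iff, div_le_one hm]; linarith [(Nat.cast_nonneg m : (0 : ℝ) ≤ m)]
    have h3 := rpow_one_add_le_one_add_mul_self h2 hα.le hα1
    have h4 : ((m : ℝ) + 1) ^ α ≤ (m + 2) ^ α * (1 - α / (m + 2)) := by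
      rw [h1, Real.mul_rpow hm.le (by linarith)]
      refine mul_le_mul_of_nonneg_left (h3.trans (le_of_eq ?_)) (by positivity)
      ring
    have h5 : (((m + 1 : ℕ) : ℝ) + 1) = m + 2 := by push_cast; ring
    rw [h0, h5]
    have hp : (0 : ℝ) ≤ ((m : ℝ) + 2) ^ α := by positivity
    calc Abin α (m + 1) * (1 + α / (m + 2))
        ≤ 2 * ((m + 2) ^ α * (1 - α / (m + 2))) * (1 + α / (m + 2)) := by
          refine mul_le_mul_of_nonneg_right (ih.trans (by linarith)) (by positivity)
      _ = 2 * (m + 2) ^ α * (1 - (α / (m + 2)) ^ 2) := by ring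
      _ ≤ 2 * (m + 2) ^ α := by
          refine mul_le_of_le_one_right (by positivity) ?_
          linarith [sq_nonneg (α / ((m : ℝ) + 2))]

lemma Abin_le {α : ℝ} (hα : 0 < α) (hα1 : α ≤ 1) (m : ℕ) :
    Abin α m ≤ 2 * ((m : ℝ) + 1) ^ α :=
  (Abin_monotone hα m.le_succ).trans (Abin_succ_le hα hα1 m)

lemma Abin_two_pow_sub_one_le {α : ℝ} (hα : 0 < α) (hα1 : α ≤ 1) (k : ℕ) :
    Abin α (2 ^ k - 1) ≤ 2 * (2 : ℝ) ^ (k * α) := by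
  refine (Abin_le hα hα1 _).trans (le_of_eq ?_)
  have h : ((2 ^ k - 1 : ℕ) : ℝ) + 1 = 2 ^ k := by
    rw [Nat.cast_sub Nat.one_le_two_pow]; push_cast; ring
  rw [h, Real.rpow_mul (by norm_num), Real.rpow_natCast]

/-- Distances from level `i` down to the last, respectively the last but one, nonzero coordinate
of `x` below `i`, shifted by one; both are capped by `i`. -/
def gaps : ℕ → WG → ℕ × ℕ
  | 0, _ => (0, 0)
  | i + 1, x => if x i = 0 then ((gaps i x).1 + 1, (gaps i x).2 + 1) else (0, (gaps i x).1 + 1)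

/-- The majorant of the dyadic blocks of the `(C,α)` Kaczmarz kernel. -/
def gapPow (α : ℝ) (i : ℕ) (x : WG) : ℝ := (2 : ℝ) ^ (((gaps i x).1 : ℝ) + (gaps i x).2 * α)

/-- The left shift by `c` coordinates. -/
def shiftW (c : ℕ) (x : WG) : WG := fun i => x (i + c)

/-- The bit-reversed Walsh character of index `l` on the first `s` coordinates. -/
def revChar (s l : ℕ) (x : WG) : ℝ :=
  (-1 : ℝ) ^ (∑ k ∈ Finset.range s, (if l.testBit k then 1 else 0) * (x (s - 1 - k)).val)

/-- Weighted sum of the bit-reversed Walsh characters over a full dyadic block. -/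
def blockSum (s : ℕ) (g : ℕ → ℝ) (x : WG) : ℝ :=
  ∑ l ∈ Finset.range (2 ^ s), g l * revChar s l x

lemma rad_eq (k : ℕ) (x : WG) : rad k x = if x k = 0 then 1 else -1 := by
  unfold rad
  split_ifs with h
  · simp [h]
  · have h1 : (x k).val ≠ 0 := fun h' => h ((ZMod.val_eq_zero _).1 h')
    have h2 := ZMod.val_lt (x k)
    rw [show (x k).val = 1 by omega, pow_one]

lemma rad_mul_self (k : ℕ) (x : WG) : rad k x * rad k x = 1 := by
  rw [rad_eq]; split_ifs <;> norm_num

lemma abs_rad (k : ℕ) (x : WG) : |rad k x| = 1 := by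
  rw [rad_eq]; split_ifs <;> norm_num

lemma abs_revChar (s l : ℕ) (x : WG) : |revChar s l x| = 1 := by
  simp [revChar, abs_pow]

lemma revChar_zero_left (l : ℕ) (x : WG) : revChar 0 l x = 1 := by simp [revChar]

lemma revChar_bot_even (s l : ℕ) (x : WG) :
    revChar (s + 1) (2 * l) x = revChar s l x := by
  unfold revChar
  congr 1
  rw [Finset.sum_range_succ']
  simp only [Nat.testBit_succ, Nat.testBit_zero]
  simp
  refine Finset.sum_congr rfl fun k _ => ?_
  rw [show s - (k + 1) = s - 1 - k by omega]

lemma revChar_bot_odd (s l : ℕ) (x : WG) :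
    revChar (s + 1) (2 * l + 1) x = rad s x * revChar s l x := by
  unfold revChar rad
  rw [← pow_add]
  congr 1
  rw [Finset.sum_range_succ', add_comm]
  simp only [Nat.testBit_succ, Nat.testBit_zero]
  have h : (2 * l + 1) / 2 = l := by omega
  simp [h]
  refine Finset.sum_congr rfl fun k _ => ?_
  rw [show s - (k + 1) = s - 1 - k by omega]

lemma revChar_top (s l : ℕ) (hl : l < 2 ^ s) (x : WG) :
    revChar (s + 1) l x = revChar s l (shiftW 1 x) := by
  unfold revChar shiftW
  congr 1
  rw [Finset.sum_range_succ, Nat.testBit_lt_two_pow hl]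
  simp
  refine Finset.sum_congr rfl fun k hk => ?_
  rw [Finset.mem_range] at hk
  rw [show s - 1 - k + 1 = s - k by omega]

lemma revChar_top_add (s l : ℕ) (hl : l < 2 ^ s) (x : WG) :
    revChar (s + 1) (2 ^ s + l) x = rad 0 x * revChar s l (shiftW 1 x) := by
  unfold revChar shiftW rad
  rw [← pow_add]
  congr 1
  rw [Finset.sum_range_succ, Nat.testBit_two_pow_add_eq, Nat.testBit_lt_two_pow hl, add_comm]
  simp
  refine Finset.sum_congr rfl fun k hk => ?_
  rw [Finset.mem_range] at hk
  rw [show s - 1 - k + 1 = s - k by omega, Nat.testBit_two_pow_add_gt hk]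

lemma revChar_eq_one (s l : ℕ) (x : WG) (hx : ∀ i < s, x i = 0) : revChar s l x = 1 := by
  unfold revChar
  rw [Finset.sum_eq_zero, pow_zero]
  intro k hk
  rw [Finset.mem_range] at hk
  rw [hx _ (by omega)]
  simp

lemma kacz_two_pow_add (i l : ℕ) (hl : l < 2 ^ i) (x : WG) :
    kacz (2 ^ i + l) x = rad i x * revChar i l x := by
  have hlog : Nat.log 2 (2 ^ i + l) = i := by
    rw [Nat.log_eq_iff (Or.inr ⟨by norm_num, by positivity⟩)]
    constructor
    · omega
    · rw [pow_succ]; omega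
  unfold kacz revChar
  rw [if_neg (by positivity), hlog]
  congr 2
  refine Finset.sum_congr rfl fun k hk => ?_
  rw [Finset.mem_range] at hk
  rw [Nat.testBit_two_pow_add_gt hk]

lemma sum_range_two_mul (f : ℕ → ℝ) (m : ℕ) :
    ∑ l ∈ Finset.range (2 * m), f l = ∑ l ∈ Finset.range m, (f (2 * l) + f (2 * l + 1)) := by
  induction m with
  | zero => simp
  | succ m ih =>
    rw [show 2 * (m + 1) = 2 * m + 1 + 1 by ring, Finset.sum_range_succ, Finset.sum_range_succ,
      ih, Finset.sum_range_succ]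
    ring

lemma blockSum_succ (s : ℕ) (g : ℕ → ℝ) (x : WG) :
    blockSum (s + 1) g x = blockSum s (fun t => g (2 * t) + rad s x * g (2 * t + 1)) x := by
  unfold blockSum
  rw [pow_succ, mul_comm, sum_range_two_mul]
  refine Finset.sum_congr rfl fun l _ => ?_
  rw [revChar_bot_even, revChar_bot_odd]
  ring

lemma abs_blockSum_reflect (s : ℕ) (g : ℕ → ℝ) (x : WG) :
    |blockSum s (fun l => g (2 ^ s - 1 - l)) x| = |blockSum s g x| := by
  induction s generalizing g with
  | zero => simp [blockSum]
  | succ s ih =>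
    rw [blockSum_succ s g, ← ih]
    have h : blockSum (s + 1) (fun l => g (2 ^ (s + 1) - 1 - l)) x
        = rad s x * blockSum s
          (fun l => (fun t => g (2 * t) + rad s x * g (2 * t + 1)) (2 ^ s - 1 - l)) x := by
      rw [blockSum_succ]
      unfold blockSum
      rw [Finset.mul_sum]
      refine Finset.sum_congr rfl fun l hl => ?_
      rw [Finset.mem_range] at hl
      beta_reduce
      rw [show 2 ^ (s + 1) - 1 - 2 * l = 2 * (2 ^ s - 1 - l) + 1 by rw [pow_succ]; omega,
        show 2 ^ (s + 1) - 1 - (2 * l + 1) = 2 * (2 ^ s - 1 - l) by rw [pow_succ]; omega]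
      linear_combination -g (2 * (2 ^ s - 1 - l) + 1) * revChar s l x * rad_mul_self s x
    rw [h, abs_mul, abs_rad, one_mul]

lemma abs_blockSum_le (s : ℕ) (g : ℕ → ℝ) (x : WG) :
    |blockSum s g x| ≤ ∑ l ∈ Finset.range (2 ^ s), |g l| := by
  refine (Finset.abs_sum_le_sum_abs _ _).trans (le_of_eq ?_)
  refine Finset.sum_congr rfl fun l _ => ?_
  rw [abs_mul, abs_revChar, mul_one]

lemma sum_sub_le_of_antitone {c : ℕ → ℝ} (hc : Antitone c) (m : ℕ) :
    ∑ t ∈ Finset.range m, (c (2 * t) - c (2 * t + 1)) ≤ c 0 - c (2 * m) := by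
  induction m with
  | zero => simp
  | succ m ih =>
    rw [Finset.sum_range_succ]
    have := hc (show 2 * m + 1 ≤ 2 * (m + 1) by omega)
    linarith

lemma sum_sub_le_of_monotone {g : ℕ → ℝ} (hg : Monotone g) (m : ℕ) :
    ∑ t ∈ Finset.range (m + 1), (g (2 * t + 1) - g (2 * t)) ≤ g (2 * m + 1) - g 0 := by
  induction m with
  | zero => simp
  | succ m ih =>
    rw [Finset.sum_range_succ]
    have := hg (show 2 * m + 1 ≤ 2 * (m + 1) by omega)
    linarith

lemma abs_blockSum_le_of_antitone (s : ℕ) (c : ℕ → ℝ) (hc : Antitone c) (hc0 : ∀ t, 0 ≤ c t)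
    (x : WG) : |blockSum s c x| ≤ ∑ t ∈ Finset.range (2 ^ (gaps s x).1), c t := by
  induction s generalizing c with
  | zero => simp [blockSum, revChar_zero_left, gaps, abs_of_nonneg (hc0 0)]
  | succ s ih =>
    rw [blockSum_succ, rad_eq, gaps]
    split_ifs with hx
    · refine (ih (fun t => c (2 * t) + 1 * c (2 * t + 1)) ?_ ?_).trans (le_of_eq ?_)
      · intro a b hab
        have h1 := hc (show 2 * a ≤ 2 * b by omega)
        have h2 := hc (show 2 * a + 1 ≤ 2 * b + 1 by omega)
        simp only
        linarith
      · intro t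
        linarith [hc0 (2 * t), hc0 (2 * t + 1)]
      · rw [pow_succ, mul_comm, sum_range_two_mul]
        simp
    · refine (abs_blockSum_le _ _ _).trans ?_
      have h : ∀ t, |c (2 * t) + -1 * c (2 * t + 1)| = c (2 * t) - c (2 * t + 1) := by
        intro t
        have := hc (show 2 * t ≤ 2 * t + 1 by omega)
        rw [abs_of_nonneg] <;> linarith
      simp only [h]
      refine (sum_sub_le_of_antitone hc _).trans ?_
      simp [hc0]

lemma abs_blockSum_le_of_concave (s : ℕ) (g : ℕ → ℝ) (hg : Monotone g)
    (hg' : Antitone fun t => g (t + 1) - g t) (x : WG) (hx : ∃ i < s, x i ≠ 0) :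
    |blockSum s g x| ≤ 2 ^ (gaps s x).1 * (g (2 ^ (gaps s x).2 - 1) - g 0) := by
  induction s generalizing g with
  | zero => simp at hx
  | succ s ih =>
    rw [blockSum_succ, rad_eq, gaps]
    split_ifs with hs
    · have hx' : ∃ i < s, x i ≠ 0 := by
        obtain ⟨i, hi, hi'⟩ := hx
        refine ⟨i, lt_of_le_of_ne (Nat.lt_succ_iff.1 hi) ?_, hi'⟩
        rintro rfl
        exact hi' hs
      refine (ih (fun t => g (2 * t) + 1 * g (2 * t + 1)) ?_ ?_ hx').trans ?_
      · intro a b hab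
        have h1 := hg (show 2 * a ≤ 2 * b by omega)
        have h2 := hg (show 2 * a + 1 ≤ 2 * b + 1 by omega)
        simp only
        linarith
      · intro a b hab
        have h1 := hg' (show 2 * a ≤ 2 * b by omega)
        have h2 := hg' (show 2 * a + 1 ≤ 2 * b + 1 by omega)
        have h3 := hg' (show 2 * a + 2 ≤ 2 * b + 2 by omega)
        simp only [mul_add, mul_one, one_mul] at h1 h2 h3 ⊢
        rw [show 2 * a + 2 + 1 = 2 * a + 3 by ring, show 2 * b + 2 + 1 = 2 * b + 3 by ring] at *
        rw [show 2 * a + 1 + 1 = 2 * a + 2 by ring, show 2 * b + 1 + 1 = 2 * b + 2 by ring] at *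
        linarith
      · set k := (gaps s x).2
        have hk : 1 ≤ 2 ^ k := Nat.one_le_two_pow
        have h1 := hg (show 2 * (2 ^ k - 1) ≤ 2 ^ (k + 1) - 1 by rw [pow_succ]; omega)
        have h2 : g (2 * (2 ^ k - 1) + 1) = g (2 ^ (k + 1) - 1) := by
          congr 1; rw [pow_succ]; omega
        have h3 := hg (show 0 ≤ 1 by omega)
        simp only [h2]
        rw [pow_succ (2 : ℝ), mul_assoc]
        refine mul_le_mul_of_nonneg_left ?_ (by positivity)
        simp
        linarith
    · have h : |blockSum s (fun t => g (2 * t) + -1 * g (2 * t + 1)) x|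
          = |blockSum s (fun t => g (2 * t + 1) - g (2 * t)) x| := by
        rw [← abs_neg]
        congr 1
        unfold blockSum
        rw [← Finset.sum_neg_distrib]
        refine Finset.sum_congr rfl fun l _ => ?_
        ring
      rw [h]
      refine (abs_blockSum_le_of_antitone s _ ?_ ?_ x).trans ?_
      · intro a b hab
        exact hg' (show 2 * a ≤ 2 * b by omega)
      · intro t
        linarith [hg (show 2 * t ≤ 2 * t + 1 by omega)]
      · set k := (gaps s x).1
        have hk : 1 ≤ 2 ^ k := Nat.one_le_two_pow
        have h1 := sum_sub_le_of_monotone hg (2 ^ k - 1)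
        rw [Nat.sub_add_cancel hk, show 2 * (2 ^ k - 1) + 1 = 2 ^ (k + 1) - 1 by
          rw [pow_succ]; omega] at h1
        simpa using h1

lemma gaps_of_forall_eq_zero (s : ℕ) (x : WG) (hx : ∀ i < s, x i = 0) : gaps s x = (s, s) := by
  induction s with
  | zero => rfl
  | succ s ih =>
    rw [gaps, if_pos (hx s s.lt_succ_self), ih fun i hi => hx i (hi.trans s.lt_succ_self)]

lemma gapPow_pos (α : ℝ) (i : ℕ) (x : WG) : 0 < gapPow α i x := by
  unfold gapPow; positivity

lemma gapPow_eq (α : ℝ) (i : ℕ) (x : WG) :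
    gapPow α i x = 2 ^ (gaps i x).1 * (2 : ℝ) ^ ((gaps i x).2 * α) := by
  rw [gapPow, Real.rpow_add (by norm_num), Real.rpow_natCast]

lemma Abin_two_pow_le {α : ℝ} (hα : 0 < α) (hα1 : α ≤ 1) (k : ℕ) :
    Abin α (2 ^ (k + 1) - 1) ≤ 4 * (2 : ℝ) ^ (k * α) := by
  refine (Abin_two_pow_sub_one_le hα hα1 (k + 1)).trans ?_
  have h : (2 : ℝ) ^ (((k + 1 : ℕ) : ℝ) * α) = 2 ^ (k * α) * 2 ^ α := by
    rw [← Real.rpow_add (by norm_num)]; push_cast; ring_nf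
  have h2 : (2 : ℝ) ^ α ≤ 2 := by
    simpa using Real.rpow_le_rpow_of_exponent_le (show (1 : ℝ) ≤ 2 by norm_num) hα1
  rw [h]
  have h3 : (0 : ℝ) < 2 ^ (k * α) := by positivity
  nlinarith

lemma abs_blockSum_Abin_le {α : ℝ} (hα : 0 < α) (hα1 : α ≤ 1) (s M : ℕ) (x : WG)
    (hx : (∃ i < s, x i ≠ 0) ∨ M ≤ 2 ^ s) :
    |blockSum s (fun l => Abin α (M + (2 ^ s - 1 - l))) x| ≤ 4 * gapPow α s x := by
  have hr := abs_blockSum_reflect s (fun t => Abin α (M + t)) x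
  rw [hr]
  by_cases h : ∃ i < s, x i ≠ 0
  · refine (abs_blockSum_le_of_concave s _ ?_ ?_ x h).trans ?_
    · exact fun a b hab => Abin_monotone hα (by omega)
    · intro a b hab
      exact Abin_diff_antitone hα hα1 (show M + a ≤ M + b by omega)
    · have h1 := Abin_add_sub_le hα hα1 M (2 ^ (gaps s x).2 - 1)
      have h2 := Abin_two_pow_sub_one_le hα hα1 (gaps s x).2
      have h3 : (0 : ℝ) < 2 ^ ((gaps s x).2 * α) := by positivity
      rw [gapPow_eq, mul_left_comm]
      refine mul_le_mul_of_nonneg_left ?_ (by positivity)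
      simp only [add_zero]
      linarith
  · have hM : M ≤ 2 ^ s := hx.resolve_left h
    push Not at h
    refine (abs_blockSum_le _ _ _).trans ?_
    rw [gapPow_eq, gaps_of_forall_eq_zero s x h]
    have h1 : ∀ l ∈ Finset.range (2 ^ s), |Abin α (M + l)| ≤ 4 * (2 : ℝ) ^ (s * α) := by
      intro l hl
      rw [Finset.mem_range] at hl
      rw [abs_of_nonneg (Abin_nonneg hα _)]
      refine (Abin_monotone hα ?_).trans (Abin_two_pow_le hα hα1 s)
      rw [pow_succ]; omega
    refine (Finset.sum_le_card_nsmul _ _ _ h1).trans (le_of_eq ?_)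
    simp
    ring

lemma shiftW_shiftW (a b : ℕ) (x : WG) : shiftW a (shiftW b x) = shiftW (a + b) x := by
  funext i
  simp [shiftW, add_assoc]

lemma abs_sum_Abin_revChar_le {α : ℝ} (hα : 0 < α) (hα1 : α ≤ 1) (A m : ℕ) (hm : m < 2 ^ A)
    (x : WG) :
    |∑ l ∈ Finset.range m, Abin α (m - 1 - l) * revChar A l x|
      ≤ 4 * ∑ s ∈ Finset.range A, gapPow α s (shiftW (A - s) x) := by
  induction A generalizing m x with
  | zero =>
    have : m = 0 := by simpa using hm
    simp [this]
  | succ A ih =>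
    have hs : ∑ s ∈ Finset.range A, gapPow α s (shiftW (A + 1 - s) x)
        = ∑ s ∈ Finset.range A, gapPow α s (shiftW (A - s) (shiftW 1 x)) := by
      refine Finset.sum_congr rfl fun s hs => ?_
      rw [Finset.mem_range] at hs
      rw [shiftW_shiftW, show A - s + 1 = A + 1 - s by omega]
    rw [Finset.sum_range_succ, hs, mul_add]
    have hpos : 0 < gapPow α A (shiftW (A + 1 - A) x) := gapPow_pos _ _ _
    rcases lt_or_ge m (2 ^ A) with h | h
    · have h1 : ∑ l ∈ Finset.range m, Abin α (m - 1 - l) * revChar (A + 1) l x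
          = ∑ l ∈ Finset.range m, Abin α (m - 1 - l) * revChar A l (shiftW 1 x) := by
        refine Finset.sum_congr rfl fun l hl => ?_
        rw [Finset.mem_range] at hl
        rw [revChar_top A l (hl.trans h)]
      rw [h1]
      linarith [ih m h (shiftW 1 x)]
    · obtain ⟨r, rfl⟩ := Nat.exists_eq_add_of_le h
      have hr : r < 2 ^ A := by rw [pow_succ] at hm; omega
      rw [Finset.sum_range_add]
      have h1 : ∑ l ∈ Finset.range (2 ^ A), Abin α (2 ^ A + r - 1 - l) * revChar (A + 1) l x
          = blockSum A (fun l => Abin α (r + (2 ^ A - 1 - l))) (shiftW 1 x) := by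
        refine Finset.sum_congr rfl fun l hl => ?_
        rw [Finset.mem_range] at hl
        rw [revChar_top A l hl, show 2 ^ A + r - 1 - l = r + (2 ^ A - 1 - l) by omega]
      have h2 : ∑ l ∈ Finset.range r,
            Abin α (2 ^ A + r - 1 - (2 ^ A + l)) * revChar (A + 1) (2 ^ A + l) x
          = rad 0 x * ∑ l ∈ Finset.range r, Abin α (r - 1 - l) * revChar A l (shiftW 1 x) := by
        rw [Finset.mul_sum]
        refine Finset.sum_congr rfl fun l hl => ?_
        rw [Finset.mem_range] at hl
        rw [revChar_top_add A l (hl.trans hr),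
          show 2 ^ A + r - 1 - (2 ^ A + l) = r - 1 - l by omega]
        ring
      rw [h1, h2]
      refine (abs_add_le _ _).trans ?_
      rw [abs_mul, abs_rad, one_mul, add_comm]
      refine add_le_add (ih r hr _) ?_
      rw [show A + 1 - A = 1 by omega]
      exact abs_blockSum_Abin_le hα hα1 A r _ (Or.inr hr.le)

lemma kacz_eq_one (A l : ℕ) (hl : l < 2 ^ A) (x : WG) (hx : ∀ i < A, x i = 0) :
    kacz l x = 1 := by
  rcases Nat.eq_zero_or_pos l with rfl | hl0
  · simp [kacz]
  · have h1 : 2 ^ Nat.log 2 l ≤ l := Nat.pow_log_le_self 2 hl0.ne'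
    have h2 : l < 2 ^ (Nat.log 2 l + 1) := Nat.lt_pow_succ_log_self (by norm_num) l
    have h3 : Nat.log 2 l < A := (Nat.pow_lt_pow_iff_right (by norm_num)).1 (h1.trans_lt hl)
    obtain ⟨r, hr⟩ := Nat.exists_eq_add_of_le h1
    have hr' : r < 2 ^ Nat.log 2 l := by rw [pow_succ] at h2; omega
    rw [hr, kacz_two_pow_add _ _ hr', rad_eq, if_pos (hx _ h3),
      revChar_eq_one _ _ _ fun i hi => hx i (hi.trans h3), one_mul]

lemma abs_sum_Abin_kacz_le {α : ℝ} (hα : 0 < α) (hα1 : α ≤ 1) (A n : ℕ) (hn : 2 ^ A ≤ n)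
    (x : WG) (hx : ∃ i < A, x i ≠ 0) :
    |∑ l ∈ Finset.range (2 ^ A), Abin α (n - 1 - l) * kacz l x|
      ≤ 4 * ∑ i ∈ Finset.range A, gapPow α i x := by
  induction A with
  | zero => simp at hx
  | succ A ih =>
    rw [pow_succ] at hn
    rw [show 2 ^ (A + 1) = 2 ^ A + 2 ^ A by rw [pow_succ]; ring, Finset.sum_range_add]
    have h2 : ∑ l ∈ Finset.range (2 ^ A), Abin α (n - 1 - (2 ^ A + l)) * kacz (2 ^ A + l) x
        = rad A x * blockSum A (fun l => Abin α (n - 2 ^ A * 2 + (2 ^ A - 1 - l))) x := by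
      unfold blockSum
      rw [Finset.mul_sum]
      refine Finset.sum_congr rfl fun l hl => ?_
      rw [Finset.mem_range] at hl
      rw [kacz_two_pow_add A l hl,
        show n - 1 - (2 ^ A + l) = n - 2 ^ A * 2 + (2 ^ A - 1 - l) by omega]
      ring
    rw [Finset.sum_range_succ, mul_add]
    by_cases h : ∃ i < A, x i ≠ 0
    · rw [h2]
      refine (abs_add_le _ _).trans (add_le_add (ih (by omega) h) ?_)
      rw [abs_mul, abs_rad, one_mul]
      exact abs_blockSum_Abin_le hα hα1 A _ x (Or.inl h)
    · push Not at h
      have hA : x A ≠ 0 := by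
        obtain ⟨i, hi, hi'⟩ := hx
        rcases Nat.lt_succ_iff_lt_or_eq.1 hi with hi | rfl
        · exact absurd (h i hi) hi'
        · exact hi'
      rw [← Finset.sum_add_distrib]
      have h3 : ∀ l ∈ Finset.range (2 ^ A),
          Abin α (n - 1 - l) * kacz l x + Abin α (n - 1 - (2 ^ A + l)) * kacz (2 ^ A + l) x
            = Abin α (n - 1 - (2 ^ A + l) + 2 ^ A) - Abin α (n - 1 - (2 ^ A + l)) := by
        intro l hl
        rw [Finset.mem_range] at hl
        rw [kacz_eq_one A l hl x h, kacz_two_pow_add A l hl, rad_eq, if_neg hA,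
          revChar_eq_one _ _ _ h, show n - 1 - (2 ^ A + l) + 2 ^ A = n - 1 - l by omega]
        ring
      have h4 : ∀ l ∈ Finset.range (2 ^ A),
          |Abin α (n - 1 - l) * kacz l x + Abin α (n - 1 - (2 ^ A + l)) * kacz (2 ^ A + l) x|
            ≤ 4 * (2 : ℝ) ^ (A * α) := by
        intro l hl
        rw [h3 l hl, abs_of_nonneg (sub_nonneg.2 (Abin_monotone hα (Nat.le_add_right _ _)))]
        have h5 := Abin_add_sub_le hα hα1 (n - 1 - (2 ^ A + l)) (2 ^ A)
        have h6 : Abin α (2 ^ A) ≤ Abin α (2 ^ (A + 1) - 1) := by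
          refine Abin_monotone hα ?_
          have := Nat.one_le_two_pow (n := A)
          rw [pow_succ]; omega
        linarith [Abin_two_pow_le hα hα1 A]
      have h7 := (Finset.abs_sum_le_sum_abs _ _).trans (Finset.sum_le_card_nsmul _ _ _ h4)
      have h8 : 0 ≤ ∑ i ∈ Finset.range A, gapPow α i x :=
        Finset.sum_nonneg fun i _ => (gapPow_pos α i x).le
      refine h7.trans ?_
      rw [gapPow_eq, gaps_of_forall_eq_zero A x h]
      simp
      linarith

lemma sum_Abin_dirK (α : ℝ) (n : ℕ) (x : WG) :
    ∑ k ∈ Finset.range (n + 1), Abin (α - 1) (n - k) * dirK k x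
      = ∑ l ∈ Finset.range n, Abin α (n - 1 - l) * kacz l x := by
  unfold dirK
  simp_rw [Finset.mul_sum]
  rw [Finset.sum_comm' (t' := Finset.range n) (s' := fun l => Finset.Ico (l + 1) (n + 1))]
  · refine Finset.sum_congr rfl fun l hl => ?_
    rw [Finset.mem_range] at hl
    rw [← Finset.sum_mul, ← sum_Abin_sub_one, Finset.sum_Ico_eq_sum_range,
      ← Finset.sum_range_reflect]
    congr 1
    rw [show n + 1 - (l + 1) = n - 1 - l + 1 by omega]
    refine Finset.sum_congr rfl fun i hi => ?_
    rw [Finset.mem_range] at hi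
    congr 1
    omega
  · intro k l
    simp only [Finset.mem_range, Finset.mem_Ico]
    omega

/-- The sum of block majorants controlling the kernels of order `A`. -/
def gapSum (α : ℝ) (A : ℕ) (x : WG) : ℝ :=
  ∑ i ∈ Finset.range A, gapPow α i x
    + ∑ s ∈ Finset.range A, gapPow α s (shiftW (A - s) x)

lemma abs_KK_le {α : ℝ} (hα : 0 < α) (hα1 : α ≤ 1) (A n : ℕ) (hn : 2 ^ A ≤ n)
    (hn' : n < 2 ^ (A + 1)) (x : WG) (hx : ∃ i < A, x i ≠ 0) :
    |KK α n x| ≤ 4 * (2 : ℝ) ^ (-(A * α)) * gapSum α A x := by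
  obtain ⟨m, rfl⟩ := Nat.exists_eq_add_of_le hn
  have hm : m < 2 ^ A := by rw [pow_succ] at hn'; omega
  have h0 : (2 : ℝ) ^ (A * α) ≤ Abin α (2 ^ A + m) := by
    refine le_trans ?_ (le_Abin hα hα1 _)
    rw [Real.rpow_mul (by norm_num), Real.rpow_natCast]
    refine Real.rpow_le_rpow (by positivity) ?_ hα.le
    push_cast
    linarith [(Nat.cast_nonneg m : (0 : ℝ) ≤ m)]
  have h1 : (0 : ℝ) < 2 ^ (A * α) := by positivity
  have h2 : |∑ l ∈ Finset.range (2 ^ A + m), Abin α (2 ^ A + m - 1 - l) * kacz l x|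
      ≤ 4 * gapSum α A x := by
    rw [Finset.sum_range_add, gapSum, mul_add]
    refine (abs_add_le _ _).trans (add_le_add (abs_sum_Abin_kacz_le hα hα1 A _ hn x hx) ?_)
    have h3 : ∑ l ∈ Finset.range m, Abin α (2 ^ A + m - 1 - (2 ^ A + l)) * kacz (2 ^ A + l) x
        = rad A x * ∑ l ∈ Finset.range m, Abin α (m - 1 - l) * revChar A l x := by
      rw [Finset.mul_sum]
      refine Finset.sum_congr rfl fun l hl => ?_
      rw [Finset.mem_range] at hl
      rw [kacz_two_pow_add A l (hl.trans hm),
        show 2 ^ A + m - 1 - (2 ^ A + l) = m - 1 - l by omega]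
      ring
    rw [h3, abs_mul, abs_rad, one_mul]
    exact abs_sum_Abin_revChar_le hα hα1 A m hm x
  have h4 : 0 ≤ 4 * gapSum α A x := (abs_nonneg _).trans h2
  rw [KK, sum_Abin_dirK, abs_mul, abs_of_nonneg (inv_nonneg.2 (Abin_nonneg hα _)),
    Real.rpow_neg (by norm_num)]
  calc _ ≤ ((2 : ℝ) ^ (A * α))⁻¹ * (4 * gapSum α A x) :=
        mul_le_mul (inv_anti₀ h1 h0) h2 (abs_nonneg _) (by positivity)
    _ = _ := by ring

lemma gaps_congr {s : ℕ} {x y : WG} (h : ∀ i < s, x i = y i) : gaps s x = gaps s y := by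
  induction s with
  | zero => rfl
  | succ s ih =>
    rw [gaps, gaps, h s s.lt_succ_self, ih fun i hi => h i (hi.trans s.lt_succ_self)]

lemma gapPow_congr (α : ℝ) {s : ℕ} {x y : WG} (h : ∀ i < s, x i = y i) :
    gapPow α s x = gapPow α s y := by
  rw [gapPow, gapPow, gaps_congr h]

lemma gapPow_zero (α : ℝ) (x : WG) : gapPow α 0 x = 1 := by
  simp [gapPow, gaps]

lemma measurable_gaps (s : ℕ) : Measurable (gaps s) := by
  induction s with
  | zero => exact measurable_const
  | succ s ih =>
    refine Measurable.ite ((measurable_pi_apply s) (measurableSet_singleton 0)) ?_ ?_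
    · exact (Measurable.of_discrete (f := fun q : ℕ × ℕ => (q.1 + 1, q.2 + 1))).comp ih
    · exact (Measurable.of_discrete (f := fun q : ℕ × ℕ => (0, q.1 + 1))).comp ih

lemma measurable_shiftW (c : ℕ) : Measurable (shiftW c) :=
  measurable_pi_lambda _ fun i => measurable_pi_apply (i + c)

lemma measurable_gapPow (α : ℝ) (s : ℕ) : Measurable (gapPow α s) :=
  (Measurable.of_discrete
    (f := fun q : ℕ × ℕ => (2 : ℝ) ^ ((q.1 : ℝ) + q.2 * α))).comp (measurable_gaps s)

instance : (μW).IsAddHaarMeasure := by unfold μW; infer_instance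

lemma μW_univ : μW Set.univ = 1 := by
  have := Measure.addHaarMeasure_self (K₀ := (⊤ : TopologicalSpace.PositiveCompacts WG))
  simpa [μW] using this

lemma measurableSet_rectW (N : ℕ) : MeasurableSet (rectW N) := by
  have : rectW N = ⋂ i : ℕ, ⋂ _ : i < N, {x : WG | x i = 0} := by
    ext x; simp [rectW]
  rw [this]
  exact MeasurableSet.iInter fun i => MeasurableSet.iInter fun _ =>
    (measurable_pi_apply i) (measurableSet_singleton 0)

lemma add_single_mem_rectW {N i : ℕ} (hi : N ≤ i) (t : WG) :
    t + Pi.single i 1 ∈ rectW N ↔ t ∈ rectW N := by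
  refine forall₂_congr fun k hk => ?_
  rw [Pi.add_apply, Pi.single_eq_of_ne (by omega), add_zero]

lemma setLIntegral_add_single {N i : ℕ} (hi : N ≤ i) (f : WG → ℝ≥0∞) :
    ∫⁻ t in rectW N, f (t + Pi.single i 1) ∂μW = ∫⁻ t in rectW N, f t ∂μW := by
  rw [← lintegral_indicator (measurableSet_rectW N), ← lintegral_indicator (measurableSet_rectW N),
    ← lintegral_add_right_eq_self (μ := μW) ((rectW N).indicator f) (Pi.single i 1 : WG)]
  refine lintegral_congr fun t => ?_
  by_cases h : t ∈ rectW N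
  · rw [Set.indicator_of_mem h, Set.indicator_of_mem ((add_single_mem_rectW hi t).2 h)]
  · rw [Set.indicator_of_notMem h,
      Set.indicator_of_notMem fun h' => h ((add_single_mem_rectW hi t).1 h')]

lemma setLIntegral_le_of_add_flip_le {N i : ℕ} (hi : N ≤ i) {f g : WG → ℝ} (hf : Measurable f)
    (hf0 : ∀ x, 0 ≤ f x) {r : ℝ} (hr : 0 ≤ r)
    (h : ∀ x, f x + f (x + Pi.single i 1) ≤ 2 * r * g x) (x : WG) :
    ∫⁻ t in rectW N, ENNReal.ofReal (f (x + t)) ∂μW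
      ≤ ENNReal.ofReal r * ∫⁻ t in rectW N, ENNReal.ofReal (g (x + t)) ∂μW := by
  have hm : Measurable fun t => ENNReal.ofReal (f (x + t)) :=
    (hf.comp (measurable_const_add x)).ennreal_ofReal
  have h2 : 2 * ∫⁻ t in rectW N, ENNReal.ofReal (f (x + t)) ∂μW
      ≤ 2 * (ENNReal.ofReal r * ∫⁻ t in rectW N, ENNReal.ofReal (g (x + t)) ∂μW) := by
    calc 2 * ∫⁻ t in rectW N, ENNReal.ofReal (f (x + t)) ∂μW
        = ∫⁻ t in rectW N, (ENNReal.ofReal (f (x + t))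
            + ENNReal.ofReal (f (x + (t + Pi.single i 1)))) ∂μW := by
          rw [lintegral_add_left hm,
            setLIntegral_add_single hi fun t => ENNReal.ofReal (f (x + t)), two_mul]
      _ ≤ ∫⁻ t in rectW N, ENNReal.ofReal (2 * r) * ENNReal.ofReal (g (x + t)) ∂μW := by
          refine lintegral_mono fun t => ?_
          rw [← ENNReal.ofReal_add (hf0 _) (hf0 _), ← ENNReal.ofReal_mul (by positivity),
            ← add_assoc]
          exact ENNReal.ofReal_le_ofReal (h _)
      _ = _ := by
          rw [lintegral_const_mul' _ _ ENNReal.ofReal_ne_top, ENNReal.ofReal_mul (by norm_num),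
            mul_assoc]
          simp
  exact (ENNReal.mul_le_mul_iff_right (by norm_num) (by norm_num)).1 h2

lemma μW_rectW_le (N : ℕ) : μW (rectW N) ≤ ENNReal.ofReal ((2 : ℝ)⁻¹ ^ N) := by
  induction N with
  | zero => simpa using (measure_mono (Set.subset_univ _)).trans μW_univ.le
  | succ N ih =>
    have h := setLIntegral_le_of_add_flip_le (le_refl N)
      (f := (rectW (N + 1)).indicator 1) (g := 1) (r := 2⁻¹)
      (measurable_one.indicator (measurableSet_rectW _))
      (fun x => Set.indicator_nonneg (fun _ _ => zero_le_one) x) (by norm_num) ?_ 0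
    · have h1 : (fun t : WG => ENNReal.ofReal ((rectW (N + 1)).indicator 1 (0 + t)))
          = (rectW (N + 1)).indicator 1 := by
        funext t
        rw [zero_add]
        by_cases ht : t ∈ rectW (N + 1) <;> simp [ht]
      have hsub : rectW (N + 1) ⊆ rectW N := fun t ht i hi => ht i (hi.trans N.lt_succ_self)
      rw [h1, lintegral_indicator_one (measurableSet_rectW _),
        Measure.restrict_apply (measurableSet_rectW _), Set.inter_eq_left.2 hsub] at h
      simp only [Pi.one_apply, ENNReal.ofReal_one, lintegral_const, one_mul,
        Measure.restrict_apply MeasurableSet.univ, Set.univ_inter] at h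
      refine h.trans ?_
      rw [pow_succ', ENNReal.ofReal_mul (by norm_num)]
      gcongr
    · intro x
      by_cases hx : x ∈ rectW (N + 1)
      · have hx' : x + Pi.single N 1 ∉ rectW (N + 1) := by
          intro h
          have := h N N.lt_succ_self
          rw [Pi.add_apply, hx N N.lt_succ_self, Pi.single_eq_same] at this
          simp at this
        simp [hx, hx']
      · by_cases hx' : x + Pi.single N 1 ∈ rectW (N + 1) <;> simp [hx, hx']

lemma zmod_two_add_one_eq_zero_iff (a : ZMod 2) : a + 1 = 0 ↔ a ≠ 0 := by
  revert a; decide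

/-- A Lyapunov function for the evolution of `gapPow α i x ^ p` in `i`. -/
def gapLyap (α p : ℝ) (i : ℕ) (x : WG) : ℝ :=
  gapPow α i x ^ p + (2 ^ p - 1)⁻¹ * (2 : ℝ) ^ ((gaps i x).1 * α * p)
    + (2 ^ p - 1)⁻¹ / (2 * (2 ^ ((1 + α) * p - 1) - 1))

lemma gapLyap_step {α p : ℝ} (hα : 0 < α) (hp : 1 < (1 + α) * p) (i : ℕ) (x : WG) :
    gapLyap α p (i + 1) x + gapLyap α p (i + 1) (x + Pi.single i 1)
      = 2 * 2 ^ ((1 + α) * p - 1) * gapLyap α p i x := by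
  have hp0 : 0 < p := by
    by_contra h
    nlinarith
  have h2p : (1 : ℝ) < 2 ^ p := Real.one_lt_rpow (by norm_num) hp0
  have hr : (1 : ℝ) < 2 ^ ((1 + α) * p - 1) := Real.one_lt_rpow (by norm_num) (by linarith)
  have hg : gaps i (x + Pi.single i 1) = gaps i x := gaps_congr fun k hk => by
    rw [Pi.add_apply, Pi.single_eq_of_ne (by omega), add_zero]
  have hxi : (x + Pi.single i 1 : WG) i = x i + 1 := by simp
  have e1 : (2 : ℝ) * 2 ^ ((1 + α) * p - 1) = 2 ^ p * 2 ^ (α * p) := by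
    rw [← Real.rpow_add (by norm_num), Real.rpow_sub_one (by norm_num)]
    ring_nf
  have hsum : ∀ j k : ℕ,
      (((2 : ℝ) ^ (((j + 1 : ℕ) : ℝ) + (k + 1 : ℕ) * α)) ^ p
          + (2 ^ p - 1)⁻¹ * (2 : ℝ) ^ ((j + 1 : ℕ) * α * p)
          + (2 ^ p - 1)⁻¹ / (2 * (2 ^ ((1 + α) * p - 1) - 1)))
        + (((2 : ℝ) ^ (((0 : ℕ) : ℝ) + (j + 1 : ℕ) * α)) ^ p
          + (2 ^ p - 1)⁻¹ * (2 : ℝ) ^ ((0 : ℕ) * α * p)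
          + (2 ^ p - 1)⁻¹ / (2 * (2 ^ ((1 + α) * p - 1) - 1)))
        = 2 * 2 ^ ((1 + α) * p - 1) * (((2 : ℝ) ^ ((j : ℝ) + k * α)) ^ p
          + (2 ^ p - 1)⁻¹ * (2 : ℝ) ^ (j * α * p)
          + (2 ^ p - 1)⁻¹ / (2 * (2 ^ ((1 + α) * p - 1) - 1))) := by
    intro j k
    have a1 : ((2 : ℝ) ^ (((j + 1 : ℕ) : ℝ) + (k + 1 : ℕ) * α)) ^ p
        = 2 * 2 ^ ((1 + α) * p - 1) * ((2 : ℝ) ^ ((j : ℝ) + k * α)) ^ p := by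
      rw [e1, ← Real.rpow_mul (by norm_num), ← Real.rpow_mul (by norm_num),
        ← Real.rpow_add (by norm_num), ← Real.rpow_add (by norm_num)]
      push_cast
      ring_nf
    have a2 : (2 : ℝ) ^ ((j + 1 : ℕ) * α * p) = 2 ^ (α * p) * 2 ^ (j * α * p) := by
      rw [← Real.rpow_add (by norm_num)]
      push_cast
      ring_nf
    have a3 : ((2 : ℝ) ^ (((0 : ℕ) : ℝ) + (j + 1 : ℕ) * α)) ^ p
        = 2 ^ (α * p) * 2 ^ (j * α * p) := by
      rw [← Real.rpow_mul (by norm_num), ← Real.rpow_add (by norm_num)]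
      push_cast
      ring_nf
    have a4 : (2 : ℝ) ^ ((0 : ℕ) * α * p) = 1 := by simp
    rw [a1, a2, a3, a4]
    set r : ℝ := 2 ^ ((1 + α) * p - 1)
    set P : ℝ := ((2 : ℝ) ^ ((j : ℝ) + k * α)) ^ p
    set Q : ℝ := (2 : ℝ) ^ (j * α * p)
    set b : ℝ := 2 ^ (α * p)
    set a : ℝ := 2 ^ p
    have ha : a - 1 ≠ 0 := by linarith
    have hr' : r - 1 ≠ 0 := by linarith
    have c1 : 2 * r * ((a - 1)⁻¹ * Q) = (a - 1)⁻¹ * (b * Q) + b * Q := by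
      rw [e1]; field_simp; ring
    have c2 : 2 * r * ((a - 1)⁻¹ / (2 * (r - 1)))
        = 2 * ((a - 1)⁻¹ / (2 * (r - 1))) + (a - 1)⁻¹ := by
      field_simp; ring
    linear_combination -c1 - c2
  unfold gapLyap gapPow
  rw [gaps, gaps, hg, hxi]
  by_cases hx : x i = 0
  · rw [if_pos hx, if_neg (by rw [hx]; decide)]
    exact hsum _ _
  · rw [if_neg hx, if_pos ((zmod_two_add_one_eq_zero_iff _).2 hx), add_comm]
    exact hsum _ _

/-- The constant comparing `gapLyap` with the power of `gapPow` it dominates. -/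
def lyapConst (α p : ℝ) : ℝ :=
  1 + (2 ^ p - 1)⁻¹ + (2 ^ p - 1)⁻¹ / (2 * (2 ^ ((1 + α) * p - 1) - 1))

lemma pos_of_one_lt_mul {α p : ℝ} (hα : 0 < α) (hp : 1 < (1 + α) * p) : 0 < p := by
  by_contra h
  nlinarith

lemma gapLyap_coeff_nonneg {α p : ℝ} (hα : 0 < α) (hp : 1 < (1 + α) * p) :
    0 ≤ ((2 : ℝ) ^ p - 1)⁻¹ ∧
      0 ≤ ((2 : ℝ) ^ p - 1)⁻¹ / (2 * (2 ^ ((1 + α) * p - 1) - 1)) := by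
  have h2p : (1 : ℝ) < 2 ^ p := Real.one_lt_rpow (by norm_num) (pos_of_one_lt_mul hα hp)
  have hr : (1 : ℝ) < 2 ^ ((1 + α) * p - 1) := Real.one_lt_rpow (by norm_num) (by linarith)
  have h1 : 0 ≤ ((2 : ℝ) ^ p - 1)⁻¹ := inv_nonneg.2 (by linarith)
  exact ⟨h1, div_nonneg h1 (by linarith)⟩

lemma one_le_lyapConst {α p : ℝ} (hα : 0 < α) (hp : 1 < (1 + α) * p) : 1 ≤ lyapConst α p := by
  obtain ⟨h1, h2⟩ := gapLyap_coeff_nonneg hα hp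
  unfold lyapConst
  linarith

lemma gapPow_rpow_le_gapLyap {α p : ℝ} (hα : 0 < α) (hp : 1 < (1 + α) * p) (i : ℕ) (x : WG) :
    gapPow α i x ^ p ≤ gapLyap α p i x := by
  obtain ⟨h1, h2⟩ := gapLyap_coeff_nonneg hα hp
  have h3 : (0 : ℝ) ≤ 2 ^ ((gaps i x).1 * α * p) := by positivity
  unfold gapLyap
  nlinarith [mul_nonneg h1 h3]

lemma fst_gaps_le_snd (i : ℕ) (x : WG) : (gaps i x).1 ≤ (gaps i x).2 := by
  induction i with
  | zero => simp [gaps]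
  | succ i ih =>
    rw [gaps]
    split_ifs
    · simpa using ih
    · simp

lemma gapLyap_le {α p : ℝ} (hα : 0 < α) (hp : 1 < (1 + α) * p) (i : ℕ) (x : WG) :
    gapLyap α p i x ≤ lyapConst α p * gapPow α i x ^ p := by
  obtain ⟨h1, h2⟩ := gapLyap_coeff_nonneg hα hp
  have hp0 := pos_of_one_lt_mul hα hp
  have h3 : (2 : ℝ) ^ ((gaps i x).1 * α * p) ≤ gapPow α i x ^ p := by
    rw [gapPow, ← Real.rpow_mul (by norm_num)]
    refine Real.rpow_le_rpow_of_exponent_le (by norm_num) ?_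
    refine mul_le_mul_of_nonneg_right ?_ hp0.le
    have h : ((gaps i x).1 : ℝ) * α ≤ (gaps i x).2 * α :=
      mul_le_mul_of_nonneg_right (by exact_mod_cast fst_gaps_le_snd i x) hα.le
    linarith [(Nat.cast_nonneg _ : (0 : ℝ) ≤ (gaps i x).1)]
  have h4 : 1 ≤ gapPow α i x ^ p := by
    refine le_trans (Real.one_le_rpow (by norm_num) (by positivity)) h3
  unfold gapLyap lyapConst
  nlinarith [mul_le_mul_of_nonneg_left h3 h1, mul_le_mul_of_nonneg_left h4 h2]

lemma measurable_gapLyap (α p : ℝ) (i : ℕ) : Measurable (gapLyap α p i) := by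
  have h : Measurable fun x : WG => (2 : ℝ) ^ ((gaps i x).1 * α * p) :=
    (Measurable.of_discrete (f := fun q : ℕ × ℕ => (2 : ℝ) ^ ((q.1 : ℝ) * α * p))).comp
      (measurable_gaps i)
  exact (((measurable_gapPow α i).pow_const p).add (h.const_mul _)).add_const _

lemma shiftW_add_single (c u : ℕ) (x : WG) :
    shiftW c (x + Pi.single (c + u) 1) = shiftW c x + Pi.single u 1 := by
  funext i
  simp only [shiftW, Pi.add_apply, Pi.single_apply]
  congr 2
  exact propext (by omega)

lemma setLIntegral_gapLyap_le {α p : ℝ} (hα : 0 < α) (hp : 1 < (1 + α) * p) {N c u : ℕ}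
    (hN : N ≤ c + u) (v : ℕ) (x : WG) :
    ∫⁻ t in rectW N, ENNReal.ofReal (gapLyap α p (u + v) (shiftW c (x + t))) ∂μW
      ≤ ENNReal.ofReal ((2 ^ ((1 + α) * p - 1)) ^ v)
        * ∫⁻ t in rectW N, ENNReal.ofReal (gapLyap α p u (shiftW c (x + t))) ∂μW := by
  induction v with
  | zero => simp
  | succ v ih =>
    rw [pow_succ', ENNReal.ofReal_mul (by positivity), mul_assoc]
    refine le_trans ?_ (mul_le_mul_right ih _)
    refine setLIntegral_le_of_add_flip_le (i := c + (u + v)) (by omega)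
      (f := fun x => gapLyap α p (u + (v + 1)) (shiftW c x))
      (g := fun x => gapLyap α p (u + v) (shiftW c x))
      ((measurable_gapLyap α p _).comp (measurable_shiftW c)) (fun y => ?_) (by positivity)
      (fun y => ?_) x
    · exact (Real.rpow_nonneg (gapPow_pos _ _ _).le _).trans (gapPow_rpow_le_gapLyap hα hp _ _)
    · rw [shiftW_add_single]
      exact (gapLyap_step hα hp (u + v) (shiftW c y)).le

lemma gapPow_shiftW_add (α : ℝ) {N c u : ℕ} (hu : u ≤ N - c) (x : WG) {t : WG}
    (ht : t ∈ rectW N) : gapPow α u (shiftW c (x + t)) = gapPow α u (shiftW c x) := by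
  refine gapPow_congr α fun i hi => ?_
  simp only [shiftW, Pi.add_apply]
  rw [ht _ (by omega), add_zero]

lemma setLIntegral_gapPow_le {α p : ℝ} (hα : 0 < α) (hp : 1 < (1 + α) * p) (N c u : ℕ) (x : WG) :
    ∫⁻ t in rectW N, ENNReal.ofReal (gapPow α u (shiftW c (x + t)) ^ p) ∂μW
      ≤ ENNReal.ofReal (lyapConst α p * (2 : ℝ)⁻¹ ^ N * ((2 ^ ((1 + α) * p - 1)) ^ (u - (N - c))
        * gapPow α (min u (N - c)) (shiftW c x) ^ p)) := by
  have hK := one_le_lyapConst hα hp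
  have hconst : ∀ w ≤ N - c, ∀ C : ℝ, 0 ≤ C →
      ∫⁻ t in rectW N, ENNReal.ofReal (C * gapPow α w (shiftW c (x + t)) ^ p) ∂μW
        ≤ ENNReal.ofReal (C * (2 : ℝ)⁻¹ ^ N * gapPow α w (shiftW c x) ^ p) := by
    intro w hw C hC
    rw [setLIntegral_congr_fun (g := fun _ => ENNReal.ofReal (C * gapPow α w (shiftW c x) ^ p))
      (measurableSet_rectW N) fun t ht => by
        simp only [gapPow_shiftW_add α hw x ht], setLIntegral_const]
    have h0 : 0 ≤ gapPow α w (shiftW c x) ^ p := Real.rpow_nonneg (gapPow_pos _ _ _).le _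
    rw [mul_right_comm, ENNReal.ofReal_mul (mul_nonneg hC h0)]
    exact mul_le_mul_right (μW_rectW_le N) _
  rcases le_total u (N - c) with h | h
  · rw [Nat.sub_eq_zero_of_le h, min_eq_left h, pow_zero, one_mul]
    refine le_trans ?_ (hconst u h _ (zero_le_one.trans hK))
    refine lintegral_mono fun t => ENNReal.ofReal_le_ofReal ?_
    exact le_mul_of_one_le_left (Real.rpow_nonneg (gapPow_pos _ _ _).le _) hK
  · rw [min_eq_right h]
    obtain ⟨v, rfl⟩ := Nat.exists_eq_add_of_le h
    rw [Nat.add_sub_cancel_left]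
    refine (lintegral_mono fun t =>
      ENNReal.ofReal_le_ofReal (gapPow_rpow_le_gapLyap hα hp _ _)).trans ?_
    refine (setLIntegral_gapLyap_le hα hp (by omega) v x).trans ?_
    rw [mul_left_comm, ENNReal.ofReal_mul (by positivity)]
    refine mul_le_mul_right ?_ _
    refine le_trans ?_ (hconst (N - c) le_rfl _ (zero_le_one.trans hK))
    exact lintegral_mono fun t => ENNReal.ofReal_le_ofReal (gapLyap_le hα hp _ _)

lemma lintegral_gapPow_le {α p : ℝ} (hα : 0 < α) (hp : 1 < (1 + α) * p) (c u : ℕ) :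
    ∫⁻ x, ENNReal.ofReal (gapPow α u (shiftW c x) ^ p) ∂μW
      ≤ ENNReal.ofReal (lyapConst α p * (2 ^ ((1 + α) * p - 1)) ^ u) := by
  have h := setLIntegral_gapPow_le hα hp 0 c u 0
  have huniv : rectW 0 = Set.univ := by simp [rectW]
  simpa [huniv, gapPow_zero] using h

/-- The dyadic majorant, up to the factor `2 ^ (-N (1 + α))`, of the maximal function. -/
def maxMajorant (α : ℝ) (N : ℕ) (x : WG) : ℝ :=
  ∑ i ∈ Finset.range (N + 1), gapPow α i x
    + ∑ w ∈ Finset.range N, gapPow α w (shiftW (N - w) x)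

lemma shiftW_zero (x : WG) : shiftW 0 x = x := rfl

lemma geom_sum_le {r : ℝ} (hr : 1 < r) (m : ℕ) :
    ∑ i ∈ Finset.range m, r ^ i ≤ (r - 1)⁻¹ * r ^ m := by
  rw [geom_sum_eq hr.ne', div_eq_inv_mul]
  have : 0 < (r - 1)⁻¹ := inv_pos.2 (by linarith)
  nlinarith

lemma setLIntegral_gapSum_le {α : ℝ} (hα : 0 < α) (N B : ℕ) (x : WG) :
    ∫⁻ t in rectW N, ENNReal.ofReal (gapSum α (N + B) (x + t)) ∂μW
      ≤ ENNReal.ofReal (lyapConst α 1 * (2 * ((2 : ℝ) ^ α - 1)⁻¹ + 1) * (2 : ℝ)⁻¹ ^ N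
        * (2 ^ α) ^ B * maxMajorant α N x) := by
  have hp : 1 < (1 + α) * 1 := by linarith
  have hK := one_le_lyapConst hα hp
  have hr : (1 : ℝ) < 2 ^ α := Real.one_lt_rpow (by norm_num) hα
  have hterm : ∀ c u, ∫⁻ t in rectW N, ENNReal.ofReal (gapPow α u (shiftW c (x + t))) ∂μW
      ≤ ENNReal.ofReal (lyapConst α 1 * (2 : ℝ)⁻¹ ^ N * ((2 ^ α) ^ (u - (N - c))
        * gapPow α (min u (N - c)) (shiftW c x))) := by
    intro c u
    have h := setLIntegral_gapPow_le hα hp N c u x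
    simpa only [Real.rpow_one, mul_one, add_sub_cancel_left] using h
  have hmeas : ∀ c u, Measurable fun t => ENNReal.ofReal (gapPow α u (shiftW c (x + t))) :=
    fun c u => ((measurable_gapPow α u).comp
      ((measurable_shiftW c).comp (measurable_const_add x))).ennreal_ofReal
  have hnn : ∀ c u y, 0 ≤ gapPow α u (shiftW c y) := fun c u y => (gapPow_pos _ _ _).le
  have hsum : ∀ (c : ℕ → ℕ),
      ∫⁻ t in rectW N,
          ENNReal.ofReal (∑ u ∈ Finset.range (N + B), gapPow α u (shiftW (c u) (x + t))) ∂μW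
        ≤ ENNReal.ofReal (lyapConst α 1 * (2 : ℝ)⁻¹ ^ N * ∑ u ∈ Finset.range (N + B),
          ((2 ^ α) ^ (u - (N - c u)) * gapPow α (min u (N - c u)) (shiftW (c u) x))) := by
    intro c
    simp_rw [ENNReal.ofReal_sum_of_nonneg fun u _ => hnn (c u) u _]
    rw [lintegral_finsetSum _ fun u _ => hmeas (c u) u, Finset.mul_sum,
      ENNReal.ofReal_sum_of_nonneg]
    · exact Finset.sum_le_sum fun u _ => hterm (c u) u
    · intro u _
      have := hnn (c u) (min u (N - c u)) x
      positivity
  have hsplit : ∀ t, ENNReal.ofReal (gapSum α (N + B) (x + t))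
      = ENNReal.ofReal (∑ u ∈ Finset.range (N + B), gapPow α u (shiftW 0 (x + t)))
        + ENNReal.ofReal (∑ u ∈ Finset.range (N + B),
          gapPow α u (shiftW (N + B - u) (x + t))) := by
    intro t
    rw [← ENNReal.ofReal_add (Finset.sum_nonneg fun u _ => hnn _ u _)
      (Finset.sum_nonneg fun u _ => hnn _ u _)]
    rfl
  simp_rw [hsplit]
  have hm0 : Measurable fun t => ENNReal.ofReal
      (∑ u ∈ Finset.range (N + B), gapPow α u (shiftW 0 (x + t))) :=
    Measurable.ennreal_ofReal (Finset.measurable_fun_sum _ fun u _ =>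
      (measurable_gapPow α u).comp ((measurable_shiftW 0).comp (measurable_const_add x)))
  rw [lintegral_add_left hm0]
  refine (add_le_add (hsum fun _ => 0) (hsum fun u => N + B - u)).trans ?_
  have hnonneg : ∀ c : ℕ → ℕ, 0 ≤ lyapConst α 1 * (2 : ℝ)⁻¹ ^ N * ∑ u ∈ Finset.range (N + B),
          ((2 ^ α) ^ (u - (N - c u)) * gapPow α (min u (N - c u)) (shiftW (c u) x)) := by
    intro c
    refine mul_nonneg (by positivity) (Finset.sum_nonneg fun u _ => ?_)
    exact mul_nonneg (by positivity) (hnn _ _ _)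
  rw [← ENNReal.ofReal_add (hnonneg _) (hnonneg _)]
  refine ENNReal.ofReal_le_ofReal ?_
  rw [← mul_add]
  set r : ℝ := 2 ^ α
  have hrB : 1 ≤ r ^ B := one_le_pow₀ hr.le
  have hg := geom_sum_le hr B
  set G : ℝ := (r - 1)⁻¹
  have hG : 0 ≤ G := inv_nonneg.2 (by linarith)
  set F : ℝ := ∑ i ∈ Finset.range N, gapPow α i x
  set T : ℝ := ∑ w ∈ Finset.range N, gapPow α w (shiftW (N - w) x)
  have hF : 0 ≤ F := Finset.sum_nonneg fun i _ => (gapPow_pos _ _ _).le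
  have hT : 0 ≤ T := Finset.sum_nonneg fun i _ => (gapPow_pos _ _ _).le
  have hP : 0 ≤ gapPow α N x := (gapPow_pos _ _ _).le
  have hS : maxMajorant α N x = F + gapPow α N x + T := by
    rw [maxMajorant, Finset.sum_range_succ]
  have hS1 : 1 ≤ F + gapPow α N x := by
    have : F + gapPow α N x = ∑ i ∈ Finset.range (N + 1), gapPow α i x := by
      rw [Finset.sum_range_succ]
    rw [this, ← gapPow_zero α x]
    exact Finset.single_le_sum (f := fun i => gapPow α i x) (fun i _ => (gapPow_pos _ _ _).le)
      (by simp)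
  have b1 : ∑ u ∈ Finset.range (N + B), r ^ (u - (N - 0)) * gapPow α (min u (N - 0)) (shiftW 0 x)
      ≤ r ^ B * F + G * r ^ B * gapPow α N x := by
    rw [Finset.sum_range_add]
    refine add_le_add ?_ ?_
    · rw [Finset.mul_sum]
      refine Finset.sum_le_sum fun i hi => ?_
      rw [Finset.mem_range] at hi
      rw [Nat.sub_zero, Nat.sub_eq_zero_of_le hi.le, min_eq_left hi.le, pow_zero, shiftW_zero]
      exact mul_le_mul_of_nonneg_right hrB (gapPow_pos _ _ _).le
    · simp only [Nat.sub_zero, Nat.add_sub_cancel_left, Nat.le_add_right, min_eq_right,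
        shiftW_zero]
      rw [← Finset.sum_mul]
      exact mul_le_mul_of_nonneg_right hg hP
  have b2 : ∑ u ∈ Finset.range (N + B), r ^ (u - (N - (N + B - u)))
        * gapPow α (min u (N - (N + B - u))) (shiftW (N + B - u) x)
      ≤ G * r ^ B + r ^ B * T := by
    rw [add_comm N B, Finset.sum_range_add]
    refine add_le_add ?_ ?_
    · refine le_trans (Finset.sum_le_sum fun u hu => ?_) hg
      rw [Finset.mem_range] at hu
      rw [show N - (B + N - u) = 0 by omega]
      simp [gapPow_zero]
    · rw [Finset.mul_sum]
      refine Finset.sum_le_sum fun w hw => ?_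
      rw [Finset.mem_range] at hw
      rw [show N - (B + N - (B + w)) = w by omega, show B + w - w = B by omega,
        show min (B + w) w = w by omega, show B + N - (B + w) = N - w by omega]
  have key : (r ^ B * F + G * r ^ B * gapPow α N x) + (G * r ^ B + r ^ B * T)
      ≤ (2 * G + 1) * (r ^ B * maxMajorant α N x) := by
    have h1 : F + G * gapPow α N x + (G + T) ≤ (2 * G + 1) * (F + gapPow α N x + T) := by
      nlinarith [mul_nonneg hG hF, mul_nonneg hG hT, mul_nonneg hG hP,
        mul_le_mul_of_nonneg_left hS1 hG]
    rw [hS]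
    nlinarith [mul_le_mul_of_nonneg_left h1 (zero_le_one.trans hrB)]
  calc _ ≤ lyapConst α 1 * (2 : ℝ)⁻¹ ^ N * ((2 * G + 1) * (r ^ B * maxMajorant α N x)) := by
        refine mul_le_mul_of_nonneg_left ?_ (by positivity)
        exact (add_le_add b1 b2).trans key
    _ = _ := by ring

lemma snd_gaps_le (i : ℕ) (x : WG) : (gaps i x).2 ≤ i := by
  induction i with
  | zero => simp [gaps]
  | succ i ih =>
    have := fst_gaps_le_snd i x
    rw [gaps]
    split_ifs <;> simp only <;> omega

lemma gapPow_le {α : ℝ} (hα : 0 < α) (i : ℕ) (x : WG) : gapPow α i x ≤ (2 ^ (1 + α)) ^ i := by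
  rw [gapPow, ← Real.rpow_mul_natCast (by norm_num)]
  refine Real.rpow_le_rpow_of_exponent_le (by norm_num) ?_
  have h2 : ((gaps i x).2 : ℝ) ≤ i := by exact_mod_cast snd_gaps_le i x
  have h1 : ((gaps i x).1 : ℝ) ≤ (gaps i x).2 := by exact_mod_cast fst_gaps_le_snd i x
  nlinarith [mul_le_mul_of_nonneg_right h2 hα.le]

lemma maxMajorant_nonneg (α : ℝ) (N : ℕ) (x : WG) : 0 ≤ maxMajorant α N x :=
  add_nonneg (Finset.sum_nonneg fun _ _ => (gapPow_pos _ _ _).le)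
    (Finset.sum_nonneg fun _ _ => (gapPow_pos _ _ _).le)

lemma two_geom_sum_le {r : ℝ} (hr : 1 < r) (N : ℕ) :
    ∑ i ∈ Finset.range (N + 1), r ^ i + ∑ i ∈ Finset.range N, r ^ i
      ≤ (r - 1)⁻¹ * (r + 1) * r ^ N := by
  have h := add_le_add (geom_sum_le hr (N + 1)) (geom_sum_le hr N)
  refine h.trans (le_of_eq ?_)
  ring

lemma maxMajorant_le {α : ℝ} (hα : 0 < α) (N : ℕ) (x : WG) :
    maxMajorant α N x
      ≤ (((2 : ℝ) ^ (1 + α)) - 1)⁻¹ * (2 ^ (1 + α) + 1) * (2 ^ (1 + α)) ^ N := by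
  refine le_trans ?_ (two_geom_sum_le (Real.one_lt_rpow (by norm_num) (by linarith)) N)
  exact add_le_add (Finset.sum_le_sum fun i _ => gapPow_le hα i _)
    (Finset.sum_le_sum fun i _ => gapPow_le hα i _)

lemma sum_rpow_le {ι : Type*} (s : Finset ι) {f : ι → ℝ} (hf : ∀ i, 0 ≤ f i) {q : ℝ}
    (hq : 0 < q) (hq1 : q ≤ 1) : (∑ i ∈ s, f i) ^ q ≤ ∑ i ∈ s, f i ^ q := by
  classical
  induction s using Finset.induction_on with
  | empty => simp [Real.zero_rpow hq.ne']
  | insert a s ha ih =>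
    rw [Finset.sum_insert ha, Finset.sum_insert ha]
    exact (Real.rpow_add_le_add_rpow (hf a) (Finset.sum_nonneg fun i _ => hf i) hq.le hq1).trans
      (add_le_add_right ih _)

lemma maxMajorant_rpow_le (α : ℝ) {q : ℝ} (hq : 0 < q) (hq1 : q ≤ 1) (N : ℕ) (x : WG) :
    maxMajorant α N x ^ q ≤ ∑ i ∈ Finset.range (N + 1), gapPow α i (shiftW 0 x) ^ q
      + ∑ w ∈ Finset.range N, gapPow α w (shiftW (N - w) x) ^ q := by
  have hnn : ∀ u y, 0 ≤ gapPow α u y := fun u y => (gapPow_pos _ _ _).le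
  refine (Real.rpow_add_le_add_rpow (Finset.sum_nonneg fun _ _ => hnn _ _)
    (Finset.sum_nonneg fun _ _ => hnn _ _) hq.le hq1).trans ?_
  exact add_le_add (sum_rpow_le _ (fun i => hnn i x) hq hq1)
    (sum_rpow_le _ (fun w => hnn w (shiftW (N - w) x)) hq hq1)

lemma lintegral_maxMajorant_rpow_le {α q : ℝ} (hα : 0 < α) (hq : 1 < (1 + α) * q) (hq1 : q ≤ 1)
    (N : ℕ) :
    ∫⁻ x, ENNReal.ofReal (maxMajorant α N x ^ q) ∂μW
      ≤ ENNReal.ofReal (lyapConst α q * ((2 ^ ((1 + α) * q - 1) - 1)⁻¹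
        * (2 ^ ((1 + α) * q - 1) + 1) * (2 ^ ((1 + α) * q - 1)) ^ N)) := by
  have hK := one_le_lyapConst hα hq
  have hr : (1 : ℝ) < 2 ^ ((1 + α) * q - 1) := Real.one_lt_rpow (by norm_num) (by linarith)
  have hnn : ∀ u y, 0 ≤ gapPow α u y ^ q := fun u y => Real.rpow_nonneg (gapPow_pos _ _ _).le _
  have hmeas : ∀ c u, Measurable fun x => ENNReal.ofReal (gapPow α u (shiftW c x) ^ q) :=
    fun c u => (((measurable_gapPow α u).comp (measurable_shiftW c)).pow_const q).ennreal_ofReal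
  have hsum : ∀ (M : ℕ) (c : ℕ → ℕ),
      ∫⁻ x, ∑ u ∈ Finset.range M, ENNReal.ofReal (gapPow α u (shiftW (c u) x) ^ q) ∂μW
        ≤ ENNReal.ofReal (lyapConst α q
          * ∑ u ∈ Finset.range M, (2 ^ ((1 + α) * q - 1)) ^ u) := by
    intro M c
    rw [lintegral_finsetSum _ fun u _ => hmeas (c u) u, Finset.mul_sum,
      ENNReal.ofReal_sum_of_nonneg fun u _ => by positivity]
    exact Finset.sum_le_sum fun u _ => lintegral_gapPow_le hα hq (c u) u
  calc ∫⁻ x, ENNReal.ofReal (maxMajorant α N x ^ q) ∂μW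
      ≤ ∫⁻ x, (∑ u ∈ Finset.range (N + 1), ENNReal.ofReal (gapPow α u (shiftW 0 x) ^ q)
          + ∑ u ∈ Finset.range N, ENNReal.ofReal (gapPow α u (shiftW (N - u) x) ^ q)) ∂μW := by
        refine lintegral_mono fun x => ?_
        rw [← ENNReal.ofReal_sum_of_nonneg fun u _ => hnn u _,
          ← ENNReal.ofReal_sum_of_nonneg fun u _ => hnn u _,
          ← ENNReal.ofReal_add (Finset.sum_nonneg fun u _ => hnn u _)
            (Finset.sum_nonneg fun u _ => hnn u _)]
        exact ENNReal.ofReal_le_ofReal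
          (maxMajorant_rpow_le α (pos_of_one_lt_mul hα hq) hq1 N x)
    _ ≤ ENNReal.ofReal (lyapConst α q * ∑ u ∈ Finset.range (N + 1), (2 ^ ((1 + α) * q - 1)) ^ u)
          + ENNReal.ofReal (lyapConst α q * ∑ u ∈ Finset.range N, (2 ^ ((1 + α) * q - 1)) ^ u) := by
        rw [lintegral_add_left (Finset.measurable_fun_sum _ fun u _ => hmeas 0 u)]
        exact add_le_add (hsum (N + 1) fun _ => 0) (hsum N fun u => N - u)
    _ ≤ _ := by
        rw [← ENNReal.ofReal_add (by positivity) (by positivity), ← mul_add]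
        exact ENNReal.ofReal_le_ofReal
          (mul_le_mul_of_nonneg_left (two_geom_sum_le hr N) (by positivity))

/-- The constant in the bound of the maximal function by `maxMajorant`. -/
def kernelConst (α : ℝ) : ℝ := 4 * (lyapConst α 1 * (2 * ((2 : ℝ) ^ α - 1)⁻¹ + 1))

lemma kernelConst_nonneg {α : ℝ} (hα : 0 < α) : 0 ≤ kernelConst α := by
  have hK := one_le_lyapConst hα (by linarith : 1 < (1 + α) * 1)
  have hr : (1 : ℝ) < 2 ^ α := Real.one_lt_rpow (by norm_num) hα
  have hG : 0 ≤ ((2 : ℝ) ^ α - 1)⁻¹ := inv_nonneg.2 (by linarith)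
  unfold kernelConst
  positivity

lemma setIntegral_abs_KK_le {α : ℝ} (hα : 0 < α) (hα1 : α ≤ 1) {N n : ℕ} (hn : 2 ^ N ≤ n) {x : WG}
    (hx : x ∉ rectW N) :
    ∫ t in rectW N, |KK α n (x + t)| ∂μW
      ≤ kernelConst α * (((2 : ℝ) ^ (1 + α)) ^ N)⁻¹ * maxMajorant α N x := by
  have hn0 : n ≠ 0 := by
    rintro rfl
    exact absurd hn (by simp)
  have hNA : N ≤ Nat.log 2 n := Nat.le_log_of_pow_le (by norm_num) hn
  obtain ⟨B, hB⟩ := Nat.exists_eq_add_of_le hNA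
  have hlow : 2 ^ (N + B) ≤ n := hB ▸ Nat.pow_log_le_self 2 hn0
  have hup : n < 2 ^ (N + B + 1) := hB ▸ Nat.lt_pow_succ_log_self (by norm_num) n
  have hM := maxMajorant_nonneg α N x
  have hR : 0 ≤ kernelConst α * (((2 : ℝ) ^ (1 + α)) ^ N)⁻¹ * maxMajorant α N x :=
    mul_nonneg (mul_nonneg (kernelConst_nonneg hα) (by positivity)) hM
  have hmain : ∫⁻ t in rectW N, ENNReal.ofReal |KK α n (x + t)| ∂μW
      ≤ ENNReal.ofReal (kernelConst α * (((2 : ℝ) ^ (1 + α)) ^ N)⁻¹ * maxMajorant α N x) := by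
    calc ∫⁻ t in rectW N, ENNReal.ofReal |KK α n (x + t)| ∂μW
        ≤ ∫⁻ t in rectW N, ENNReal.ofReal (4 * (2 : ℝ) ^ (-((N + B : ℕ) * α)))
            * ENNReal.ofReal (gapSum α (N + B) (x + t)) ∂μW := by
          refine setLIntegral_mono' (measurableSet_rectW N) fun t ht => ?_
          rw [← ENNReal.ofReal_mul (by positivity)]
          refine ENNReal.ofReal_le_ofReal (abs_KK_le hα hα1 (N + B) n hlow hup (x + t) ?_)
          simp only [rectW, Set.mem_ofPred_eq, not_forall] at hx
          obtain ⟨i, hi, hxi⟩ := hx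
          refine ⟨i, by omega, ?_⟩
          rwa [Pi.add_apply, ht i hi, add_zero]
      _ ≤ _ := by
          rw [lintegral_const_mul' _ _ ENNReal.ofReal_ne_top]
          refine (mul_le_mul_right (setLIntegral_gapSum_le hα N B x) _).trans ?_
          rw [← ENNReal.ofReal_mul (by positivity)]
          refine ENNReal.ofReal_le_ofReal (le_of_eq ?_)
          have e1 : (2 : ℝ) ^ (-((N + B : ℕ) * α)) = ((2 ^ α) ^ N)⁻¹ * ((2 ^ α) ^ B)⁻¹ := by
            rw [Real.rpow_neg (by norm_num), mul_comm, Real.rpow_mul_natCast (by norm_num), pow_add,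
              mul_inv]
          have e2 : (((2 : ℝ) ^ (1 + α)) ^ N)⁻¹ = 2⁻¹ ^ N * ((2 ^ α) ^ N)⁻¹ := by
            rw [Real.rpow_one_add' (by norm_num) (by linarith), mul_pow, mul_inv, inv_pow]
          have e3 : ((2 : ℝ) ^ α) ^ B ≠ 0 := by positivity
          rw [e1, e2, kernelConst]
          field_simp
  by_cases hint : Integrable (fun t => |KK α n (x + t)|) (μW.restrict (rectW N))
  · rw [integral_eq_lintegral_of_nonneg_ae (ae_of_all _ fun t => abs_nonneg _)
      hint.aestronglyMeasurable]
    exact ENNReal.toReal_le_of_le_ofReal hR hmain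
  · rwa [integral_undef hint]

lemma iSup_integral_abs_KK_nonneg (α : ℝ) (N : ℕ) (x : WG) :
    0 ≤ ⨆ n ∈ {m : ℕ | 2 ^ N ≤ m}, ∫ t in rectW N, |KK α n (x + t)| ∂μW :=
  Real.iSup_nonneg fun _ => Real.iSup_nonneg fun _ => integral_nonneg fun _ => abs_nonneg _

lemma iSup_integral_abs_KK_le {α : ℝ} (hα : 0 < α) (hα1 : α ≤ 1) {N : ℕ} {x : WG}
    (hx : x ∉ rectW N) :
    ⨆ n ∈ {m : ℕ | 2 ^ N ≤ m}, ∫ t in rectW N, |KK α n (x + t)| ∂μW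
      ≤ kernelConst α * (((2 : ℝ) ^ (1 + α)) ^ N)⁻¹ * maxMajorant α N x := by
  have hR : 0 ≤ kernelConst α * (((2 : ℝ) ^ (1 + α)) ^ N)⁻¹ * maxMajorant α N x :=
    mul_nonneg (mul_nonneg (kernelConst_nonneg hα) (by positivity)) (maxMajorant_nonneg α N x)
  exact Real.iSup_le (fun n => Real.iSup_le (fun hn => setIntegral_abs_KK_le hα hα1 hn hx) hR) hR

lemma rpow_le_mul_rpow_of_le {a b C q p : ℝ} (ha : 0 ≤ a) (hab : a ≤ b) (hb : b ≤ C)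
    (hq : 0 < q) (hqp : q ≤ p) : a ^ p ≤ C ^ (p - q) * b ^ q := by
  have hb0 := ha.trans hab
  calc a ^ p ≤ b ^ p := Real.rpow_le_rpow ha hab (hq.le.trans hqp)
    _ = b ^ (p - q) * b ^ q := by
        rw [← Real.rpow_add_of_nonneg hb0 (by linarith) hq.le, sub_add_cancel]
    _ ≤ C ^ (p - q) * b ^ q :=
        mul_le_mul_of_nonneg_right (Real.rpow_le_rpow hb0 hb (by linarith))
          (Real.rpow_nonneg hb0 _)

/-- Simon: for `0 < α ≤ 1` and `p > 1/(1+α)` there is `c_p` with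
`∫_{G∖I_N} (sup_{n ≥ 2^N} ∫_{I_N} |K_n^{κ,α}(x+t)| dμ(t))^p dμ(x) ≤ c_p 2^{-N}`. -/
theorem simon_kernel_estimate (α : ℝ) (hα : 0 < α) (hα1 : α ≤ 1)
    (p : ℝ) (hp : 1 / (1 + α) < p) :
    ∃ c : ℝ, 0 < c ∧ ∀ N : ℕ,
      ∫⁻ x in (rectW N)ᶜ,
          ENNReal.ofReal
            ((⨆ n ∈ {m : ℕ | 2 ^ N ≤ m}, ∫ t in rectW N, |KK α n (x + t)| ∂ μW) ^ p)
          ∂ μW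
        ≤ ENNReal.ofReal (c * 2 ^ (-(N : ℝ))) := by
  obtain ⟨q, hq, hq1, hqp⟩ : ∃ q : ℝ, 1 < (1 + α) * q ∧ q ≤ 1 ∧ q ≤ p := by
    refine ⟨min p 1, ?_, min_le_right _ _, min_le_left _ _⟩
    have h1 : 1 / (1 + α) < 1 := by
      rw [div_lt_one (by linarith)]
      linarith
    have := (div_lt_iff₀' (by linarith : 0 < 1 + α)).1 (lt_min hp h1)
    exact this
  have hq0 := pos_of_one_lt_mul hα hq
  have hK0 := kernelConst_nonneg hα
  set D : ℝ := ((2 : ℝ) ^ (1 + α) - 1)⁻¹ * (2 ^ (1 + α) + 1) with hD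
  set L : ℝ := lyapConst α q * ((2 ^ ((1 + α) * q - 1) - 1)⁻¹ * (2 ^ ((1 + α) * q - 1) + 1))
    with hL
  have hD0 : 0 ≤ D := by
    have : (1 : ℝ) < 2 ^ (1 + α) := Real.one_lt_rpow (by norm_num) (by linarith)
    have : 0 ≤ ((2 : ℝ) ^ (1 + α) - 1)⁻¹ := inv_nonneg.2 (by linarith)
    positivity
  have hL0 : 0 ≤ L := by
    have := one_le_lyapConst hα hq
    have : (1 : ℝ) < 2 ^ ((1 + α) * q - 1) := Real.one_lt_rpow (by norm_num) (by linarith)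
    have : 0 ≤ ((2 : ℝ) ^ ((1 + α) * q - 1) - 1)⁻¹ := inv_nonneg.2 (by linarith)
    positivity
  set E : ℝ := (kernelConst α * D) ^ (p - q) * kernelConst α ^ q with hE
  have hE0 : 0 ≤ E := by positivity
  refine ⟨E * L + 1, by positivity, fun N => ?_⟩
  have hpoint : ∀ x ∈ (rectW N)ᶜ,
      ENNReal.ofReal ((⨆ n ∈ {m : ℕ | 2 ^ N ≤ m}, ∫ t in rectW N, |KK α n (x + t)| ∂ μW) ^ p)
        ≤ ENNReal.ofReal (E * (((2 : ℝ) ^ (1 + α)) ^ N)⁻¹ ^ q)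
          * ENNReal.ofReal (maxMajorant α N x ^ q) := by
    intro x hx
    have hM := maxMajorant_nonneg α N x
    rw [← ENNReal.ofReal_mul (by positivity)]
    refine ENNReal.ofReal_le_ofReal ?_
    have hbound : kernelConst α * (((2 : ℝ) ^ (1 + α)) ^ N)⁻¹ * maxMajorant α N x
        ≤ kernelConst α * D := by
      rw [mul_assoc]
      refine mul_le_mul_of_nonneg_left ?_ hK0
      rw [inv_mul_le_iff₀ (by positivity), mul_comm]
      exact maxMajorant_le hα N x
    refine (rpow_le_mul_rpow_of_le (iSup_integral_abs_KK_nonneg α N x)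
      (iSup_integral_abs_KK_le hα hα1 hx) hbound hq0 hqp).trans (le_of_eq ?_)
    rw [Real.mul_rpow (by positivity) hM, Real.mul_rpow (z := q) hK0 (by positivity), hE]
    ring
  have hscale : (((2 : ℝ) ^ (1 + α)) ^ N)⁻¹ ^ q * (2 ^ ((1 + α) * q - 1)) ^ N
      = 2 ^ (-(N : ℝ)) := by
    rw [← Real.rpow_mul_natCast (by norm_num), ← Real.rpow_mul_natCast (by norm_num),
      ← Real.rpow_neg (by norm_num), ← Real.rpow_mul (by norm_num), ← Real.rpow_add (by norm_num)]
    ring_nf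
  calc _ ≤ ∫⁻ x in (rectW N)ᶜ, ENNReal.ofReal (E * (((2 : ℝ) ^ (1 + α)) ^ N)⁻¹ ^ q)
          * ENNReal.ofReal (maxMajorant α N x ^ q) ∂μW :=
        setLIntegral_mono' (measurableSet_rectW N).compl hpoint
    _ ≤ ENNReal.ofReal (E * (((2 : ℝ) ^ (1 + α)) ^ N)⁻¹ ^ q)
          * ∫⁻ x, ENNReal.ofReal (maxMajorant α N x ^ q) ∂μW := by
        rw [lintegral_const_mul' _ _ ENNReal.ofReal_ne_top]
        exact mul_le_mul_right (setLIntegral_le_lintegral _ _) _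
    _ ≤ ENNReal.ofReal (E * (((2 : ℝ) ^ (1 + α)) ^ N)⁻¹ ^ q)
          * ENNReal.ofReal (L * (2 ^ ((1 + α) * q - 1)) ^ N) := by
        refine mul_le_mul_right ((lintegral_maxMajorant_rpow_le hα hq hq1 N).trans_eq ?_) _
        rw [hL, mul_assoc (lyapConst α q)]
    _ ≤ ENNReal.ofReal ((E * L + 1) * 2 ^ (-(N : ℝ))) := by
        rw [← ENNReal.ofReal_mul (by positivity)]
        refine ENNReal.ofReal_le_ofReal ?_
        rw [mul_mul_mul_comm, hscale]
        exact mul_le_mul_of_nonneg_right (by linarith) (by positivity)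

end
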